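/- arXiv:0909.2461 — 6 statements merged into one kernel-verified Lean document; each statement's English description precedes it below -/
import Mathlib

section
/- Let n be a positive integer and let S be a sequence of n elements of ℤ/nℤ. If h(S) < 4 or h(S) ≥ n/2, then S contains a nonempty subsequence T with |T| ≤ h(S) and Index(T) = n (in particular there is an integer m coprime to n with σ(|mT|_n) = n). -/
/-- `|x|ₙ`: the smallest positive integer in the residue class `x` modulo `n`
(so `|0|ₙ = n`). -/
def nval (n : ℕ) (x : ZMod n) : ℕ := if x = 0 then n else x.val

/-- `σ(|mS|ₙ)`: the sum of `|m·a|ₙ` over all terms `a` of `S`. -/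
def sigmaM (n : ℕ) (m : ℤ) (S : Multiset (ZMod n)) : ℕ :=
  (S.map fun a => nval n (m • a)).sum

/-- `h(S)`: the maximal multiplicity of an element occurring in `S`. -/
def maxRep {α : Type*} [DecidableEq α] (S : Multiset α) : ℕ :=
  S.toFinset.sup fun a => S.count a

open scoped Pointwise

theorem scherk_aux {G : Type*} [AddCommGroup G] [DecidableEq G] (k : ℕ) :
    ∀ A B : Finset G, B.card ≤ k → (0 : G) ∈ A → (0 : G) ∈ B →
      (∀ a ∈ A, ∀ b ∈ B, a + b = 0 → a = 0) → A.card + B.card ≤ (A + B).card + 1 := by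
  induction k with
  | zero =>
    intro A B hB _ h0 _
    have := Finset.card_pos.2 ⟨0, h0⟩
    omega
  | succ k ih =>
    intro A B hB hA0 hB0 hu
    by_cases hex : ∃ e ∈ A, ∃ b ∈ B, e + b ∉ A
    · obtain ⟨e, he, b, hb, hne⟩ := hex
      set E : Finset G := B.filter (fun x => e + x ∈ A) with hE
      set F : Finset G := B.filter (fun x => ¬ (e + x ∈ A)) with hF
      have hcard : E.card + F.card = B.card := Finset.card_filter_add_card_filter_not _
      have hFpos : 0 < F.card := Finset.card_pos.2 ⟨b, by simp [hF, hb, hne]⟩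
      set A' : Finset G := A ∪ F.image (fun x => e + x) with hA'
      have hA'card : A'.card = A.card + F.card := by
        rw [hA', Finset.card_union_of_disjoint, Finset.card_image_of_injective]
        · exact add_right_injective e
        · rw [Finset.disjoint_left]
          intro x hx hx'
          rw [Finset.mem_image] at hx'
          obtain ⟨y, hy, rfl⟩ := hx'
          exact (Finset.mem_filter.1 hy).2 hx
      have hsub : A' + E ⊆ A + B := by
        intro z hz
        obtain ⟨x, hx, y, hy, rfl⟩ := Finset.mem_add.1 hz
        have hy' := Finset.mem_filter.1 hy
        rcases Finset.mem_union.1 hx with hx | hx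
        · exact Finset.add_mem_add hx hy'.1
        · obtain ⟨w, hw, rfl⟩ := Finset.mem_image.1 hx
          have : e + w + y = (e + y) + w := by abel
          rw [this]
          exact Finset.add_mem_add hy'.2 (Finset.mem_filter.1 hw).1
      have := ih A' E (by omega) (Finset.mem_union_left _ hA0)
        (by simp [hE, hB0, he]) (by
          intro x hx y hy hxy
          have hy' := Finset.mem_filter.1 hy
          rcases Finset.mem_union.1 hx with hx | hx
          · exact hu x hx y hy'.1 hxy
          · obtain ⟨w, hw, rfl⟩ := Finset.mem_image.1 hx
            have h1 : (e + y) + w = 0 := by rw [← hxy]; abel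
            have h2 := hu _ hy'.2 w (Finset.mem_filter.1 hw).1 h1
            rw [h2, zero_add] at h1
            have h3 := hu e he y hy'.1 h2
            simp [h1, h3])
      have := Finset.card_le_card hsub
      omega
    · push Not at hex
      have hB1 : B = {0} := by
        apply Finset.eq_singleton_iff_unique_mem.2 ⟨hB0, ?_⟩
        intro b hb
        have himg : A.image (fun x => x + b) = A := by
          apply Finset.eq_of_subset_of_card_le
          · intro z hz
            obtain ⟨x, hx, rfl⟩ := Finset.mem_image.1 hz
            exact hex x hx b hb
          · rw [Finset.card_image_of_injective _ (add_left_injective b)]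
        have : (0 : G) ∈ A.image (fun x => x + b) := by rw [himg]; exact hA0
        obtain ⟨x, hx, hxb⟩ := Finset.mem_image.1 this
        have h3 := hu x hx b hb hxb
        simpa [h3] using hxb
      subst hB1
      simp

theorem scherk {G : Type*} [AddCommGroup G] [DecidableEq G] (A B : Finset G)
    (hA0 : (0 : G) ∈ A) (hB0 : (0 : G) ∈ B)
    (hu : ∀ a ∈ A, ∀ b ∈ B, a + b = 0 → a = 0) : A.card + B.card ≤ (A + B).card + 1 :=
  scherk_aux _ A B le_rfl hA0 hB0 hu

theorem count_le_maxRep {α : Type*} [DecidableEq α] (S : Multiset α) (a : α) :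
    S.count a ≤ maxRep S := by
  by_cases h : a ∈ S
  · exact Finset.le_sup (f := fun a => S.count a) (Multiset.mem_toFinset.2 h)
  · simp [Multiset.count_eq_zero_of_notMem h]

/-- Existence of a short zero-sum subsequence when the multiplicity is at most three. -/
theorem short_zero_sum (n : ℕ) [NeZero n] (S : Multiset (ZMod n))
    (hcard : Multiset.card S = n) (h : maxRep S < 4) :
    ∃ T ≤ S, T ≠ 0 ∧ Multiset.card T ≤ maxRep S ∧ Multiset.card T ≤ 3 ∧ T.sum = 0 := by
  by_cases h0 : (0 : ZMod n) ∈ S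
  · have := count_le_maxRep S 0
    have h1 := Multiset.one_le_count_iff_mem.2 h0
    exact ⟨{0}, by simpa using h0, by simp, by simp; omega, by simp, by simp⟩
  by_contra hcon
  push Not at hcon
  let P : ℕ → Finset (ZMod n) := fun i => Finset.univ.filter (fun x => i + 1 ≤ S.count x)
  have hP0 : ∀ i, (0 : ZMod n) ∉ P i := by
    intro i; simp [P, Multiset.count_eq_zero_of_notMem h0]
  let A : ℕ → Finset (ZMod n) := fun i => insert 0 (P i)
  have hA0 : ∀ i, (0 : ZMod n) ∈ A i := fun i => by simp [A]
  have hAc : ∀ i, (A i).card = (P i).card + 1 := fun i => Finset.card_insert_of_notMem (hP0 i)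
  have hAm : ∀ i x, x ∈ A i → x = 0 ∨ i + 1 ≤ S.count x := by
    intro i x hx; simpa [A, P] using hx
  have hsum : (P 0).card + (P 1).card + (P 2).card = n := by
    have h1 : ∑ x : ZMod n, S.count x = n := by
      exact (Multiset.sum_count_eq_card (fun a _ => Finset.mem_univ a)).trans hcard
    refine Eq.trans ?_ h1
    simp only [P, Finset.card_filter, ← Finset.sum_add_distrib]
    apply Finset.sum_congr rfl
    intro x _
    have := count_le_maxRep S x
    split_ifs <;> omega
  have huniq : ∀ a ∈ A 0, ∀ b ∈ A 1, ∀ c ∈ A 2, a + b + c = 0 → a = 0 ∧ b = 0 ∧ c = 0 := by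
    intro a ha b hb c hc habc
    by_contra hne
    let T : Multiset (ZMod n) := ({a, b, c} : Multiset (ZMod n)).filter (· ≠ 0)
    have ha' := hAm _ _ ha
    have hb' := hAm _ _ hb
    have hc' := hAm _ _ hc
    have hma := count_le_maxRep S a
    have hmb := count_le_maxRep S b
    have hmc := count_le_maxRep S c
    have hTS : T ≤ S := by
      rw [Multiset.le_iff_count]
      intro x
      by_cases hx : x = 0
      · subst hx; simp [T, Multiset.count_filter]
      · have : T.count x = (if x = a then 1 else 0) + (if x = b then 1 else 0)
            + (if x = c then 1 else 0) := by
          simp only [T, Multiset.count_filter, Multiset.insert_eq_cons, Multiset.count_cons,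
            Multiset.count_singleton]
          simp [hx]; omega
        rw [this]
        by_cases h1 : x = a <;> by_cases h2 : x = b <;> by_cases h3 : x = c <;>
          simp only [h1, h2, h3, if_true, if_false] <;> grind
    have hTc : Multiset.card T = (if a ≠ 0 then 1 else 0) + (if b ≠ 0 then 1 else 0)
            + (if c ≠ 0 then 1 else 0) := by
      simp only [T, Multiset.insert_eq_cons, Multiset.filter_cons, Multiset.filter_singleton]
      by_cases h1 : a = 0 <;> by_cases h2 : b = 0 <;> by_cases h3 : c = 0 <;> simp [h1, h2, h3]
    have hTsum : T.sum = a + b + c := by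
      simp only [T, Multiset.insert_eq_cons, Multiset.filter_cons, Multiset.filter_singleton]
      by_cases h1 : a = 0 <;> by_cases h2 : b = 0 <;> by_cases h3 : c = 0 <;>
        simp [h1, h2, h3, add_assoc, add_left_comm]
    have hT0 : T ≠ 0 := by
      intro hT
      rw [hT, Multiset.card_zero] at hTc
      by_cases h1 : a = 0 <;> by_cases h2 : b = 0 <;> by_cases h3 : c = 0 <;>
        simp [h1, h2, h3] at hTc hne
    have hle : Multiset.card T ≤ maxRep S := by
      rw [hTc]; grind
    have hle3 : Multiset.card T ≤ 3 := by omega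
    exact hcon T hTS hT0 hle hle3 (by rw [hTsum, habc])
  have s1 := scherk (A 0) (A 1) (hA0 0) (hA0 1) (by
    intro a ha b hb hab
    exact (huniq a ha b hb 0 (hA0 2) (by simpa using hab)).1)
  have s2 := scherk (A 0 + A 1) (A 2)
    (by simpa using Finset.add_mem_add (hA0 0) (hA0 1)) (hA0 2) (by
    intro x hx c hc hxc
    obtain ⟨a, ha, b, hb, rfl⟩ := Finset.mem_add.1 hx
    obtain ⟨h1, h2, -⟩ := huniq a ha b hb c hc hxc
    simp [h1, h2])
  have s3 : (A 0 + A 1 + A 2).card ≤ n := by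
    simpa [ZMod.card] using Finset.card_le_univ (A 0 + A 1 + A 2)
  have := hAc 0
  have := hAc 1
  have := hAc 2
  omega

theorem index_short (n : ℕ) [NeZero n] (T : Multiset (ZMod n)) (hT : T ≠ 0)
    (h3 : Multiset.card T ≤ 3) (h0 : (0 : ZMod n) ∉ T) (hs : T.sum = 0) :
    ∃ m : ℤ, IsCoprime m (n : ℤ) ∧ sigmaM n m T = n := by
  have hpos : 0 < Multiset.card T := Multiset.card_pos.2 hT
  have hv : ∀ x : ZMod n, x ≠ 0 → 0 < x.val ∧ x.val < n := fun x hx =>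
    ⟨Nat.pos_of_ne_zero (by simpa [ZMod.val_eq_zero] using hx), ZMod.val_lt x⟩
  have hn : 0 < n := Nat.pos_of_ne_zero (NeZero.ne n)
  have hc : Multiset.card T = 1 ∨ Multiset.card T = 2 ∨ Multiset.card T = 3 := by omega
  rcases hc with hc | hc | hc
  · obtain ⟨a, rfl⟩ := Multiset.card_eq_one.1 hc
    simp at hs h0
    exact absurd hs.symm h0
  · obtain ⟨a, b, rfl⟩ := Multiset.card_eq_two.1 hc
    have ha : a ≠ 0 := by rintro rfl; simp at h0
    have hb : b ≠ 0 := by rintro rfl; simp at h0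
    refine ⟨1, isCoprime_one_left, ?_⟩
    have hd : n ∣ a.val + b.val := by
      rw [← ZMod.natCast_eq_zero_iff]
      simpa using hs
    have := hv a ha
    have := hv b hb
    simp [sigmaM, nval, ha, hb]
    obtain ⟨k, hk⟩ := hd
    have : k < 2 := by by_contra hk2; nlinarith
    have : k ≠ 0 := by rintro rfl; omega
    obtain rfl : k = 1 := by omega
    omega
  · obtain ⟨a, b, c, rfl⟩ := Multiset.card_eq_three.1 hc
    have ha : a ≠ 0 := by rintro rfl; simp at h0
    have hb : b ≠ 0 := by rintro rfl; simp at h0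
    have hc : c ≠ 0 := by rintro rfl; simp at h0
    have hd : n ∣ a.val + b.val + c.val := by
      rw [← ZMod.natCast_eq_zero_iff]
      simpa [add_assoc] using hs
    have := hv a ha
    have := hv b hb
    have := hv c hc
    obtain ⟨k, hk⟩ := hd
    have : k < 3 := by by_contra hk2; nlinarith
    have : k ≠ 0 := by rintro rfl; omega
    have hk12 : k = 1 ∨ k = 2 := by omega
    rcases hk12 with rfl | rfl
    · refine ⟨1, isCoprime_one_left, ?_⟩
      simp [sigmaM, nval, ha, hb, hc]
      omega
    · refine ⟨-1, isCoprime_one_left.neg_left, ?_⟩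
      simp [sigmaM, nval, ha, hb, hc, ZMod.neg_val]
      omega

/-- The combinatorial selection: a list of `d` numbers in `[1, d-1]`. -/
theorem select {α : Type*} [DecidableEq α] (f : α → ℕ) (d : ℕ) (hd : 0 < d) (R : Multiset α)
    (hR : Multiset.card R = d) (h1 : ∀ x ∈ R, 1 ≤ f x) (h2 : ∀ x ∈ R, f x < d) :
    ∃ U ≤ R, d ≤ (U.map f).sum ∧ (U.map f).sum + Multiset.card U ≤ 2 * d := by
  have hcs : ∀ (V : Multiset α) (c : ℕ), (∀ x ∈ V, c ≤ f x) →
      Multiset.card V * c ≤ (V.map f).sum := by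
    intro V c hV
    have := Multiset.card_nsmul_le_sum (s := V.map f) (a := c) (by
      intro x hx
      obtain ⟨y, hy, rfl⟩ := Multiset.mem_map.1 hx
      exact hV y hy)
    simpa using this
  have hex : ∃ k, ∃ U ≤ R, d ≤ (U.map f).sum ∧ Multiset.card U = k :=
    ⟨_, R, le_rfl, by have := hcs R 1 h1; omega, rfl⟩
  classical
  obtain ⟨U, hU, hdU, hUk⟩ := Nat.find_spec hex
  have hmin := fun m (hm : m < Nat.find hex) => Nat.find_min hex hm
  rw [← hUk] at hmin
  refine ⟨U, hU, hdU, ?_⟩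
  have hU0 : U ≠ 0 := by rintro rfl; simp at hdU; omega
  obtain ⟨x, hx, hxmin⟩ := Finset.exists_min_image U.toFinset f (by
    obtain ⟨y, hy⟩ := Multiset.exists_mem_of_ne_zero hU0
    exact ⟨y, Multiset.mem_toFinset.2 hy⟩)
  rw [Multiset.mem_toFinset] at hx
  obtain ⟨V, rfl⟩ := Multiset.exists_cons_of_mem hx
  have hVlt : (V.map f).sum < d := by
    by_contra hge
    exact hmin (Multiset.card V) (by simp)
      ⟨V, (Multiset.le_cons_self V x).trans hU, by omega, rfl⟩
  have hV := hcs V (f x) (fun y hy => hxmin y (by simp [hy]))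
  have hx1 := h1 x (Multiset.mem_of_le hU hx)
  have hx2 := h2 x (Multiset.mem_of_le hU hx)
  have hVc : Multiset.card V ≠ 0 := by
    intro h
    rw [Multiset.card_eq_zero] at h
    subst h
    simp at hdU
    omega
  simp only [Multiset.map_cons, Multiset.sum_cons, Multiset.card_cons] at *
  obtain ⟨p, hp⟩ : ∃ p, Multiset.card V = p + 1 := ⟨_, (Nat.succ_pred_eq_of_ne_zero hVc).symm⟩
  obtain ⟨q, hq⟩ : ∃ q, f x = q + 1 := ⟨f x - 1, by omega⟩
  rw [hp, hq] at hV
  rw [hp, hq]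
  nlinarith [Nat.zero_le (p * q)]

theorem unit_index (n : ℕ) [NeZero n] (T : Multiset (ZMod n)) (u : (ZMod n)ˣ)
    (h : (T.map fun a => nval n ((u : ZMod n) * a)).sum = n) :
    ∃ m : ℤ, IsCoprime m (n : ℤ) ∧ sigmaM n m T = n := by
  refine ⟨((u : ZMod n).val : ℤ), ?_, ?_⟩
  · exact Nat.isCoprime_iff_coprime.2 (ZMod.val_coe_unit_coprime u)
  · refine Eq.trans ?_ h
    simp [sigmaM]

theorem large_case (n : ℕ) [NeZero n] (S : Multiset (ZMod n))
    (hcard : Multiset.card S = n) (h0 : (0 : ZMod n) ∉ S)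
    (h : n ≤ 2 * maxRep S) :
    ∃ T ≤ S, T ≠ 0 ∧ Multiset.card T ≤ maxRep S ∧
      ∃ m : ℤ, IsCoprime m (n : ℤ) ∧ sigmaM n m T = n := by
  have hn : 0 < n := Nat.pos_of_ne_zero (NeZero.ne n)
  have hS0 : S ≠ 0 := by rintro rfl; simp at hcard; omega
  obtain ⟨g, hg, hgc⟩ : ∃ g ∈ S, maxRep S = S.count g := by
    have hne : S.toFinset.Nonempty := by
      obtain ⟨y, hy⟩ := Multiset.exists_mem_of_ne_zero hS0
      exact ⟨y, Multiset.mem_toFinset.2 hy⟩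
    obtain ⟨g, hg, hgc⟩ := Finset.exists_mem_eq_sup _ hne (fun a => S.count a)
    exact ⟨g, Multiset.mem_toFinset.1 hg, hgc⟩
  have hg0 : g ≠ 0 := by rintro rfl; exact h0 hg
  generalize maxRep S = k at *
  obtain ⟨d, ⟨e, hde⟩, v, hv, hgd⟩ := ZMod.eq_unit_mul_divisor g
  obtain ⟨w, rfl⟩ := hv
  have hwg : ((w⁻¹ : (ZMod n)ˣ) : ZMod n) * g = (d : ZMod n) := by
    rw [hgd, ← mul_assoc]; simp
  have hd0 : (d : ZMod n) ≠ 0 := by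
    intro h; rw [h, mul_zero] at hgd; exact hg0 hgd
  have hdpos : 0 < d := by
    rcases Nat.eq_zero_or_pos d with h | h
    · subst h; simp at hd0
    · exact h
  have hepos : 0 < e := by
    rcases Nat.eq_zero_or_pos e with h | h
    · subst h; omega
    · exact h
  have hdn : d < n := by
    rcases lt_or_ge d n with h | h
    · exact h
    · have : d = n := by nlinarith
      rw [this] at hd0; simp at hd0
  have hnd : nval n (d : ZMod n) = d := by
    rw [nval, if_neg hd0, ZMod.val_natCast, Nat.mod_eq_of_lt hdn]
  by_cases hek : e ≤ k
  · refine ⟨Multiset.replicate e g, ?_, ?_, by simpa using hek, ?_⟩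
    · rw [← Multiset.le_count_iff_replicate_le]; omega
    · rw [← Multiset.card_pos]; simpa using hepos
    · apply unit_index n _ w⁻¹
      rw [Multiset.map_replicate, hwg, hnd, Multiset.sum_replicate, smul_eq_mul, hde, mul_comm]
  have hd1 : d = 1 := by
    by_contra hne
    have : 2 ≤ d := by omega
    nlinarith
  subst hd1
  obtain rfl : e = n := by omega
  rename_i instNe
  -- the remaining terms
  set R := S.filter (fun x => ¬ (g = x)) with hR
  have hsplit : Multiset.replicate k g + R = S := by
    rw [hgc, ← Multiset.filter_eq S g]
    exact Multiset.filter_add_not _ _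
  have hRc : Multiset.card R = e - k := by
    have := congrArg Multiset.card hsplit
    simp at this
    omega
  let f : ZMod e → ℕ := fun x => (((w⁻¹ : (ZMod e)ˣ) : ZMod e) * x).val
  have hR0 : ∀ x ∈ R, x ≠ 0 := by
    intro x hx hx0
    subst hx0
    exact h0 (Multiset.mem_filter.1 hx).1
  have hw0 : ∀ x, x ≠ 0 → ((w⁻¹ : (ZMod e)ˣ) : ZMod e) * x ≠ 0 := by
    intro x hx
    simpa using hx
  have hnf : ∀ x ∈ R, nval e (((w⁻¹ : (ZMod e)ˣ) : ZMod e) * x) = f x := by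
    intro x hx
    rw [nval, if_neg (hw0 x (hR0 x hx))]
  have hf2 : ∀ x ∈ R, 2 ≤ f x := by
    intro x hx
    have h1 : f x ≠ 0 := by
      intro h; exact hw0 x (hR0 x hx) ((ZMod.val_eq_zero _).1 h)
    have h2 : f x ≠ 1 := by
      intro h
      have h3 : ((w⁻¹ : (ZMod e)ˣ) : ZMod e) * x = ((1 : ℕ) : ZMod e) := by
        rw [← h, ZMod.natCast_zmod_val]
      rw [← hwg] at h3
      exact (Multiset.mem_filter.1 hx).2 ((w⁻¹).isUnit.mul_left_cancel h3).symm
    omega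
  -- a combination lemma
  have key : ∀ U ≤ R, (U.map f).sum ≤ e → e - (U.map f).sum + Multiset.card U ≤ k →
      ∃ T ≤ S, T ≠ 0 ∧ Multiset.card T ≤ k ∧
      ∃ m : ℤ, IsCoprime m (e : ℤ) ∧ sigmaM e m T = e := by
    intro U hU hs hc
    have hsum : ((Multiset.replicate (e - (U.map f).sum) g + U).map
        fun a => nval e (((w⁻¹ : (ZMod e)ˣ) : ZMod e) * a)).sum = e := by
      rw [Multiset.map_add, Multiset.sum_add, Multiset.map_replicate, hwg, hnd,
        Multiset.sum_replicate, Multiset.map_congr rfl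
          (fun x hx => hnf x (Multiset.mem_of_le hU hx))]
      simp only [smul_eq_mul, mul_one]
      omega
    refine ⟨Multiset.replicate (e - (U.map f).sum) g + U, ?_, ?_, by simpa using hc,
      unit_index e _ w⁻¹ hsum⟩
    · rw [← hsplit]
      exact add_le_add ((Multiset.replicate_le_replicate g).2 (by omega)) hU
    · intro hz
      rw [hz] at hsum
      simp at hsum
      omega
  by_cases hbig : ∃ x ∈ R, e - k < f x
  · obtain ⟨x, hx, hfx⟩ := hbig
    have hlt : f x < e := ZMod.val_lt _
    exact key {x} (by simpa using hx) (by simp; omega) (by simp; omega)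
  · push Not at hbig
    obtain ⟨U, hU, hU1, hU2⟩ := select (fun x => f x - 1) (e - k) (by omega) R hRc
      (fun x hx => by have := hf2 x hx; show 1 ≤ f x - 1; omega)
      (fun x hx => by
        have := hf2 x hx; have := hbig x hx; show f x - 1 < e - k; omega)
    have hUs : (U.map f).sum = (U.map (fun x => f x - 1)).sum + Multiset.card U := by
      have : U.map f = U.map (fun x => (f x - 1) + 1) :=
        Multiset.map_congr rfl (fun x hx => by
          have := hf2 x (Multiset.mem_of_le hU hx); omega)
      rw [this, Multiset.sum_map_add]
      simp
    exact key U hU (by omega) (by omega)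

theorem stmt_0 (n : ℕ) (hn : 0 < n) (S : Multiset (ZMod n))
    (hcard : Multiset.card S = n)
    (h : maxRep S < 4 ∨ n ≤ 2 * maxRep S) :
    ∃ T ≤ S, T ≠ 0 ∧ Multiset.card T ≤ maxRep S ∧
      ∃ m : ℤ, IsCoprime m (n : ℤ) ∧ sigmaM n m T = n := by
  have : NeZero n := ⟨by omega⟩
  by_cases h0 : (0 : ZMod n) ∈ S
  · have h1 := count_le_maxRep S 0
    have h2 := Multiset.one_le_count_iff_mem.2 h0
    exact ⟨{0}, by simpa using h0, by simp, by simp; omega, 1, isCoprime_one_left,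
      by simp [sigmaM, nval]⟩
  rcases h with h | h
  · obtain ⟨T, hTS, hT0, hTc, hT3, hTs⟩ := short_zero_sum n S hcard h
    exact ⟨T, hTS, hT0, hTc, index_short n T hT0 hT3
      (fun hz => h0 (Multiset.mem_of_le hTS hz)) hTs⟩
  · exact large_case n S hcard h0 h
end

section
/- Let p > 24318 be a prime and let S be a sequence of p elements of ℤ/pℤ, none equal to 0. If h(S) ≥ (p-2)/10, then S contains a nonempty subsequence T with index p, i.e., there is an integer m coprime to p with σ(|mT|_p) = p. -/
/-- One-dimensional greedy filling. -/
lemma fill {ι : Type*} [DecidableEq ι] (v : ι → ℕ) (V lo hi : ℕ) (hV : V ≤ hi) (L : Finset ι)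
    (hL : ∀ i ∈ L, lo + v i ≤ hi) (hs : lo ≤ V + ∑ i ∈ L, v i) :
    ∃ L' ⊆ L, lo ≤ V + ∑ i ∈ L', v i ∧ V + ∑ i ∈ L', v i ≤ hi := by
  induction L using Finset.induction_on with
  | empty => exact ⟨∅, le_refl _, hs, by simpa using hV⟩
  | insert a L0 ha ih =>
    by_cases h : lo ≤ V + ∑ i ∈ L0, v i
    · obtain ⟨L', h1, h2⟩ := ih (fun i hi' => hL i (Finset.mem_insert_of_mem hi')) h
      exact ⟨L', h1.trans (Finset.subset_insert _ _), h2⟩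
    · refine ⟨insert a L0, le_refl _, hs, ?_⟩
      have := hL a (Finset.mem_insert_self _ _)
      rw [Finset.sum_insert ha]
      omega

/-- Fixing the residue modulo `m` with at most `m - 1` elements. -/
lemma residue_fix {ι : Type*} [DecidableEq ι] (v : ι → ℕ) (m : ℕ) (hm : 1 ≤ m) (C : Finset ι)
    (hC : C.card = m - 1) (ρ : ZMod m) (hρ : IsUnit ρ) (hv : ∀ i ∈ C, (v i : ZMod m) = ρ)
    (τ : ZMod m) : ∃ C' ⊆ C, ((∑ i ∈ C', v i : ℕ) : ZMod m) = τ := by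
  have : NeZero m := ⟨by omega⟩
  obtain ⟨u, rfl⟩ := hρ
  have hj := ZMod.val_lt (τ * ((u⁻¹ : (ZMod m)ˣ) : ZMod m))
  obtain ⟨C', h1, h2⟩ := Finset.exists_subset_card_eq
    (show (τ * ((u⁻¹ : (ZMod m)ˣ) : ZMod m)).val ≤ C.card by omega)
  refine ⟨C', h1, ?_⟩
  rw [Nat.cast_sum, Finset.sum_congr rfl (fun i hi => hv i (h1 hi)), Finset.sum_const, h2,
    nsmul_eq_mul, ZMod.natCast_val, ZMod.cast_id', id, mul_assoc, Units.inv_mul, mul_one]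

/-- The combined filling lemma in the world of the multiplier `m`. -/
lemma fillA {ι : Type*} [DecidableEq ι] (p s m : ℕ) (x : ι → ℕ) (G : Finset ι)
    (hno : ∀ B ⊆ G, ∀ k, 1 ≤ k → k < p → ∀ t ≤ s, ∑ i ∈ B, (k * x i) % p + k * t ≠ p)
    (hm : 1 ≤ m) (hmp : m < p) (B L C : Finset ι) (hBG : B ⊆ G) (hLG : L ⊆ G) (hCG : C ⊆ G)
    (hBL : Disjoint B L) (hBC : Disjoint B C) (hLC : Disjoint L C)
    (hC : C.card = m - 1) (c : ℕ) (hc : Nat.Coprime c m) (hpm : Nat.Coprime p m)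
    (hCc : ∀ i ∈ C, m * x i / p = c) (d : ℕ) (hd : ∑ i ∈ C, (m * x i) % p ≤ d)
    (hB : ∑ i ∈ B, (m * x i) % p + d ≤ p)
    (hL : ∀ i ∈ L, (m * x i) % p + d ≤ m * s ∧ (m * x i) % p + d ≤ p) :
    ∑ i ∈ B, (m * x i) % p + ∑ i ∈ L, (m * x i) % p + m * s < p := by
  by_contra hcon
  push Not at hcon
  obtain ⟨L', hL', h1, h2⟩ := fill (fun i => (m * x i) % p) (∑ i ∈ B, (m * x i) % p) (p - m * s)
    (p - d) (by omega) L (fun i hi => by have := hL i hi; omega) (by omega)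
  have hu : IsUnit (-(c * p : ℕ) : ZMod m) := by
    rw [IsUnit.neg_iff, ZMod.isUnit_iff_coprime]
    exact Nat.Coprime.mul_left hc hpm
  obtain ⟨C', hC', h3⟩ := residue_fix (fun i => (m * x i) % p) m hm C hC _ hu
    (fun i hi => by
      have h := Nat.div_add_mod (m * x i) p
      rw [hCc i hi] at h
      have h' := congrArg (Nat.cast : ℕ → ZMod m) h
      push_cast at h' ⊢
      rw [ZMod.natCast_self, zero_mul] at h'
      linear_combination h')
    ((p : ZMod m) - ((∑ i ∈ B, (m * x i) % p + ∑ i ∈ L', (m * x i) % p : ℕ) : ZMod m))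
  have h4 : ∑ i ∈ C', (m * x i) % p ≤ d :=
    (Finset.sum_le_sum_of_subset hC').trans hd
  set W := ∑ i ∈ B, (m * x i) % p + ∑ i ∈ L', (m * x i) % p with hW
  set D := ∑ i ∈ C', (m * x i) % p with hD
  have h5 : ((W + D : ℕ) : ZMod m) = (p : ℕ) := by
    push_cast at h3 ⊢
    rw [h3]; ring
  rw [ZMod.natCast_eq_natCast_iff] at h5
  obtain ⟨t, ht⟩ := (Nat.modEq_iff_dvd' (by omega)).1 h5
  have hts : t ≤ s := by
    by_contra h
    have : m * (s + 1) ≤ m * t := Nat.mul_le_mul_left _ (by omega)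
    rw [mul_add] at this
    omega
  refine hno ((B ∪ L') ∪ C') ?_ m hm hmp t hts ?_
  · exact Finset.union_subset (Finset.union_subset hBG (hL'.trans hLG)) (hC'.trans hCG)
  · rw [Finset.sum_union, Finset.sum_union]
    · omega
    · exact Finset.disjoint_of_subset_right hL' hBL
    · rw [Finset.disjoint_union_left]
      exact ⟨Finset.disjoint_of_subset_right hC' hBC,
        Finset.disjoint_of_subset_left hL' (Finset.disjoint_of_subset_right hC' hLC)⟩

/-- Dirichlet approximation, with the reduced fraction. -/
lemma assign (p s a : ℕ) (hp : p.Prime) (hbig : 24318 < p) (hs : p / 10 ≤ s) (h1 : s < a)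
    (h2 : a + s < p) :
    ∃ m, 2 ≤ m ∧ m ≤ 9 ∧
      (((m * a) % p ≤ p / 10 ∧ Nat.Coprime (m * a / p) m ∧ 1 ≤ m * a / p ∧ m * a / p < m) ∨
       (p ≤ (m * a) % p + p / 10 ∧ Nat.Coprime (m * a / p + 1) m ∧ m * a / p + 1 < m)) := by
  have hex : ∃ m, 1 ≤ m ∧ m ≤ 9 ∧ ((m * a) % p ≤ p / 10 ∨ p ≤ (m * a) % p + p / 10) := by
    obtain ⟨k, hk, hk9, h⟩ := Real.exists_nat_abs_mul_sub_round_le ((a : ℝ) / p)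
      (show 0 < 9 by norm_num)
    refine ⟨k, hk, hk9, ?_⟩
    set j := round ((k : ℝ) * ((a : ℝ) / p)) with hj
    have hp0 : (0 : ℝ) < p := by exact_mod_cast hp.pos
    have h3 : |(k : ℝ) * a - j * p| ≤ p / 10 := by
      have : (k : ℝ) * a - j * p = ((k : ℝ) * ((a : ℝ) / p) - j) * p := by field_simp
      rw [this, abs_mul, abs_of_pos hp0]
      norm_num at h
      calc _ ≤ (1 / 10 : ℝ) * p := by gcongr
        _ = _ := by ring
    rw [abs_le] at h3
    have h4 : 10 * ((k : ℤ) * a - j * p) ≤ p := by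
      have : 10 * ((k : ℝ) * a - j * p) ≤ p := by linarith
      exact_mod_cast this
    have h5 : -(p : ℤ) ≤ 10 * ((k : ℤ) * a - j * p) := by
      have : -(p : ℝ) ≤ 10 * ((k : ℝ) * a - j * p) := by linarith
      exact_mod_cast this
    have h6 := Nat.div_add_mod (k * a) p
    have h7 := Nat.mod_lt (k * a) hp.pos
    set Q := k * a / p
    set R := k * a % p
    have h8 : (k : ℤ) * a = p * Q + R := by exact_mod_cast h6.symm
    rw [h8] at h4 h5
    have hpz : (0 : ℤ) < p := by exact_mod_cast hp.pos
    have hR : (R : ℤ) < p := by exact_mod_cast h7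
    have hR0 : (0 : ℤ) ≤ R := by positivity
    have e1 : (Q : ℤ) - j < 1 := by
      by_contra hc
      nlinarith
    have e2 : -2 < (Q : ℤ) - j := by
      by_contra hc
      nlinarith
    have : (Q : ℤ) - j = 0 ∨ (Q : ℤ) - j = -1 := by omega
    rcases this with h | h
    · left
      have : j = Q := by omega
      rw [this] at h4
      have : 10 * (R : ℤ) ≤ p := by linarith
      omega
    · right
      have : j = Q + 1 := by omega
      rw [this] at h5
      have : -(p : ℤ) ≤ 10 * (R - p) := by linarith
      omega
  classical
  have hmin := fun k (hk : k < Nat.find hex) => Nat.find_min hex hk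
  obtain ⟨hm1, hm9, hm⟩ := Nat.find_spec hex
  set m := Nat.find hex with hmdef
  have hp0 := hp.pos
  have h6 := Nat.div_add_mod (m * a) p
  have h7 := Nat.mod_lt (m * a) hp.pos
  have hQ : m * a / p < m := by
    rw [Nat.div_lt_iff_lt_mul hp.pos]
    exact Nat.mul_lt_mul_of_pos_left (by omega) (by omega)
  have hm2 : 2 ≤ m := by
    by_contra h
    have h : m = 1 := by omega
    rw [h, one_mul, Nat.mod_eq_of_lt (by omega)] at hm
    omega
  refine ⟨m, hm2, hm9, ?_⟩
  set Q := m * a / p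
  set R := m * a % p
  rcases hm with hm | hm
  · left
    have hcop : Nat.Coprime Q m := by
      by_contra hg
      have hg0 : 0 < Nat.gcd Q m := Nat.gcd_pos_of_pos_right _ (by omega)
      have hg2 : 2 ≤ Nat.gcd Q m := by
        unfold Nat.Coprime at hg; omega
      obtain ⟨Q', hQ'⟩ := Nat.gcd_dvd_left Q m
      obtain ⟨m', hm'⟩ := Nat.gcd_dvd_right Q m
      set g := Nat.gcd Q m
      have hgR : g ∣ R := by
        have e1 : g ∣ p * Q + R := by rw [h6, hm', mul_assoc]; exact dvd_mul_right _ _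
        have e2 : g ∣ p * Q := by rw [hQ']; exact ⟨p * Q', by ring⟩
        exact (Nat.dvd_add_right e2).1 e1
      obtain ⟨R', hR'⟩ := hgR
      have e3 : m' * a = R' + p * Q' := by
        have : g * (m' * a) = g * (R' + p * Q') := by
          calc g * (m' * a) = g * m' * a := by ring
            _ = m * a := by rw [← hm']
            _ = p * Q + R := h6.symm
            _ = p * (g * Q') + g * R' := by rw [← hQ', ← hR']
            _ = _ := by ring
        exact Nat.eq_of_mul_eq_mul_left hg0 this
      have hRR : R' ≤ R := by rw [hR']; exact Nat.le_mul_of_pos_left _ hg0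
      have hm0 : 1 ≤ m' := by
        rcases Nat.eq_zero_or_pos m' with h | h
        · rw [h] at hm'; omega
        · exact h
      have hmm : m' < m := by nlinarith
      refine hmin m' hmm ⟨hm0, by omega, Or.inl ?_⟩
      rw [e3, Nat.add_mul_mod_self_left, Nat.mod_eq_of_lt (by omega)]
      omega
    refine ⟨hm, hcop, ?_, hQ⟩
    by_contra h
    have h : Q = 0 := Nat.eq_zero_of_not_pos h
    rw [h, Nat.coprime_zero_left] at hcop
    omega
  · right
    have hcop : Nat.Coprime (Q + 1) m := by
      by_contra hg
      have hg0 : 0 < Nat.gcd (Q + 1) m := Nat.gcd_pos_of_pos_right _ (by omega)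
      have hg2 : 2 ≤ Nat.gcd (Q + 1) m := by
        unfold Nat.Coprime at hg; omega
      obtain ⟨Q', hQ'⟩ := Nat.gcd_dvd_left (Q + 1) m
      obtain ⟨m', hm'⟩ := Nat.gcd_dvd_right (Q + 1) m
      set g := Nat.gcd (Q + 1) m
      obtain ⟨E, hE⟩ : ∃ E, R + E = p := ⟨p - R, by omega⟩
      have h8 : m * a + E = p * (Q + 1) := by rw [mul_add]; omega
      have hgR : g ∣ E := by
        have e1 : g ∣ m * a + E := by rw [h8]; exact dvd_mul_of_dvd_right (Nat.gcd_dvd_left _ _) _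
        have e2 : g ∣ m * a := dvd_mul_of_dvd_left (Nat.gcd_dvd_right _ _) _
        exact (Nat.dvd_add_right e2).1 e1
      obtain ⟨R', hR'⟩ := hgR
      have e3 : m' * a + R' = p * Q' := by
        have : g * (m' * a + R') = g * (p * Q') := by
          calc g * (m' * a + R') = g * m' * a + g * R' := by ring
            _ = m * a + E := by rw [← hm', ← hR']
            _ = p * (Q + 1) := h8
            _ = p * (g * Q') := by rw [← hQ']
            _ = _ := by ring
        exact Nat.eq_of_mul_eq_mul_left hg0 this
      have hRR : R' ≤ E := by rw [hR']; exact Nat.le_mul_of_pos_left _ hg0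
      have hR0 : 1 ≤ R' := by
        rcases Nat.eq_zero_or_pos R' with h | h
        · rw [h] at hR'; omega
        · exact h
      have hm0 : 1 ≤ m' := by
        rcases Nat.eq_zero_or_pos m' with h | h
        · rw [h] at hm'; omega
        · exact h
      have hmm : m' < m := by nlinarith
      refine hmin m' hmm ⟨hm0, by omega, Or.inr ?_⟩
      obtain ⟨Q'', rfl⟩ : ∃ Q'', Q' = Q'' + 1 := by
        refine ⟨Q' - 1, ?_⟩
        rcases Nat.eq_zero_or_pos Q' with h | h
        · rw [h] at e3; omega
        · omega
      have e4 : m' * a = (p - R') + p * Q'' := by rw [mul_add] at e3; omega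
      rw [e4, Nat.add_mul_mod_self_left, Nat.mod_eq_of_lt (by omega)]
      omega
    refine ⟨hm, hcop, ?_⟩
    by_contra h
    have h : Q + 1 = m := by omega
    rw [h, Nat.coprime_self] at hcop
    omega

/-- A negative class cannot contain `m` elements. -/
lemma negclass {ι : Type*} [DecidableEq ι] (p s m : ℕ) (x : ι → ℕ) (G : Finset ι)
    (hp : p.Prime) (hbig : 24318 < p) (hs : p / 10 ≤ s)
    (hno : ∀ B ⊆ G, ∀ k, 1 ≤ k → k < p → ∀ t ≤ s, ∑ i ∈ B, (k * x i) % p + k * t ≠ p)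
    (hm : 2 ≤ m) (hm9 : m ≤ 9) (c : ℕ) (hc : Nat.Coprime (c + 1) m) (B : Finset ι) (hB : B ⊆ G)
    (hcard : B.card = m) (hBc : ∀ i ∈ B, m * x i / p = c)
    (hBr : ∀ i ∈ B, p ≤ (m * x i) % p + p / 10) : False := by
  obtain ⟨k, hk, hk1⟩ := Nat.exists_mul_mod_eq_one_of_coprime hc (by omega)
  have hw := Nat.div_add_mod ((c + 1) * k) m
  rw [hk1] at hw
  set w := (c + 1) * k / m
  have hk0 : 1 ≤ k := by
    rcases Nat.eq_zero_or_pos k with h | h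
    · rw [h, mul_zero] at hw; omega
    · exact h
  have hE : ∀ i ∈ B, m * x i + (p - (m * x i) % p) = p * (c + 1) := by
    intro i hi
    have h1 := Nat.div_add_mod (m * x i) p
    have h2 := Nat.mod_lt (m * x i) hp.pos
    rw [hBc i hi] at h1
    rw [mul_add]
    omega
  have hf : ∀ i ∈ B, m * ((k * x i) % p) + k * (p - (m * x i) % p) = p := by
    intro i hi
    have h1 := hE i hi
    have h2 := hBr i hi
    set E := p - (m * x i) % p
    have hE10 : 10 * E ≤ p := by omega
    have hkE : k * E ≤ 8 * E := Nat.mul_le_mul_right _ (by omega)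
    have h3 : m * (k * x i) + k * E = m * (p * w) + p := by
      calc m * (k * x i) + k * E = k * (m * x i + E) := by ring
        _ = p * ((c + 1) * k) := by rw [h1]; ring
        _ = p * (m * w + 1) := by rw [hw]
        _ = _ := by ring
    have h4 : p * w ≤ k * x i := by
      have : m * (p * w) ≤ m * (k * x i) := by omega
      exact Nat.le_of_mul_le_mul_left this (by omega)
    obtain ⟨f, hf⟩ := Nat.exists_eq_add_of_le h4
    rw [hf, mul_add] at h3
    have h5 : f ≤ m * f := Nat.le_mul_of_pos_left _ (by omega)
    have h6 : 2 * f ≤ m * f := Nat.mul_le_mul_right _ hm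
    have hp0 := hp.pos
    rw [hf, Nat.mul_add_mod_self_left, Nat.mod_eq_of_lt (by omega)]
    omega
  have hsum : m * ∑ i ∈ B, x i + ∑ i ∈ B, (p - (m * x i) % p) = m * (p * (c + 1)) := by
    rw [Finset.mul_sum, ← Finset.sum_add_distrib, Finset.sum_congr rfl hE, Finset.sum_const,
      hcard, smul_eq_mul]
  have hdvd : m ∣ ∑ i ∈ B, (p - (m * x i) % p) :=
    (Nat.dvd_add_right (dvd_mul_right m (∑ i ∈ B, x i))).1 ⟨_, hsum⟩
  obtain ⟨t, ht⟩ := hdvd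
  have hsum2 : m * ∑ i ∈ B, (k * x i) % p + k * ∑ i ∈ B, (p - (m * x i) % p) = m * p := by
    rw [Finset.mul_sum, Finset.mul_sum, ← Finset.sum_add_distrib, Finset.sum_congr rfl hf,
      Finset.sum_const, hcard, smul_eq_mul]
  have hle : ∑ i ∈ B, (p - (m * x i) % p) ≤ m * (p / 10) := by
    have := Finset.sum_le_card_nsmul B (fun i => p - (m * x i) % p) (p / 10)
      (fun i hi => by have := hBr i hi; omega)
    rwa [hcard, smul_eq_mul] at this
  have htq : t ≤ p / 10 := by
    rw [ht] at hle
    exact Nat.le_of_mul_le_mul_left hle (by omega)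
  refine hno B hB k hk0 (by omega) t (by omega) ?_
  rw [ht] at hsum2
  apply Nat.eq_of_mul_eq_mul_left (show 0 < m by omega)
  rw [← hsum2]
  ring

/-- A class with denominator `l ∤ m` supplies a sum between `p / 2` and `p`. -/
lemma vbuild {ι : Type*} [DecidableEq ι] (p m l : ℕ) (x : ι → ℕ) (hp : p.Prime)
    (hm9 : m ≤ 9) (hl : 2 ≤ l) (hl9 : l ≤ 9) (hlm : ¬ l ∣ m)
    (d : ℕ) (hd : Nat.Coprime d l) (D : Finset ι) (hD : 8 ≤ D.card)
    (hDd : ∀ i ∈ D, l * x i / p = d) (hDr : ∀ i ∈ D, 144 * ((l * x i) % p) < p) :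
    ∃ B ⊆ D, p ≤ 2 * ∑ i ∈ B, (m * x i) % p ∧
      144 * (l * ∑ i ∈ B, (m * x i) % p) ≤ 144 * ((l - 1) * p) + m * ((l - 1) * p) := by
  have hp0 := hp.pos
  have hw := Nat.div_add_mod (m * d) l
  have hul := Nat.mod_lt (m * d) (show l > 0 by omega)
  have hu0 : 1 ≤ m * d % l := by
    by_contra h
    have h : m * d % l = 0 := by omega
    exact hlm (Nat.Coprime.dvd_of_dvd_mul_right hd.symm (Nat.dvd_of_mod_eq_zero h))
  set u := m * d % l
  set w := m * d / l
  have hku : u * ((l - 1) / u) ≤ l - 1 := Nat.mul_div_le _ _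
  have hku2 : l - 1 < u * ((l - 1) / u) + u := by
    have := Nat.lt_mul_div_succ (l - 1) (show 0 < u by omega)
    rwa [mul_add, mul_one] at this
  have hk1 : 1 ≤ (l - 1) / u := by
    rw [Nat.le_div_iff_mul_le (by omega)]; omega
  have hkl : (l - 1) / u ≤ l - 1 := Nat.div_le_self _ _
  set k := (l - 1) / u
  have hu2 : u ≤ u * k := Nat.le_mul_of_pos_right _ (by omega)
  obtain ⟨B, hBD, hBk⟩ := Finset.exists_subset_card_eq (show k ≤ D.card by omega)
  have hf : ∀ i ∈ D, l * ((m * x i) % p) = p * u + m * ((l * x i) % p) := by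
    intro i hi
    have h1 := Nat.div_add_mod (l * x i) p
    have h2 := hDr i hi
    rw [hDd i hi] at h1
    set e := (l * x i) % p
    have h3 : l * (m * x i) = l * (p * w) + (p * u + m * e) := by
      calc l * (m * x i) = m * (l * x i) := by ring
        _ = p * (m * d) + m * e := by rw [← h1]; ring
        _ = p * (l * w + u) + m * e := by rw [hw]
        _ = _ := by ring
    have h4 : p * w ≤ m * x i := by
      have : l * (p * w) ≤ l * (m * x i) := by omega
      exact Nat.le_of_mul_le_mul_left this (by omega)
    obtain ⟨f, hf⟩ := Nat.exists_eq_add_of_le h4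
    rw [hf, mul_add] at h3
    have hme : m * e ≤ 9 * e := Nat.mul_le_mul_right _ hm9
    have hpu : p * u ≤ p * (l - 1) := Nat.mul_le_mul_left _ (by omega)
    have hpl : p * (l - 1) + p = p * l := by
      obtain ⟨l', rfl⟩ : ∃ l', l = l' + 1 := ⟨l - 1, by omega⟩
      rw [Nat.add_sub_cancel]; ring
    have hfp : f < p := by
      have : l * f < l * p := by rw [mul_comm l p]; omega
      exact Nat.lt_of_mul_lt_mul_left this
    rw [hf, Nat.mul_add_mod_self_left, Nat.mod_eq_of_lt hfp]
    omega
  have hsum : l * ∑ i ∈ B, (m * x i) % p = p * (u * k) + m * ∑ i ∈ B, (l * x i) % p := by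
    rw [Finset.mul_sum, Finset.sum_congr rfl (fun i hi => hf i (hBD hi)), Finset.sum_add_distrib,
      Finset.sum_const, hBk, Finset.mul_sum, smul_eq_mul]
    ring
  have hes : 144 * ∑ i ∈ B, (l * x i) % p ≤ k * p := by
    rw [Finset.mul_sum, ← hBk, ← smul_eq_mul (a := B.card)]
    exact Finset.sum_le_card_nsmul B _ p (fun i hi => (hDr i (hBD hi)).le)
  refine ⟨B, hBD, ?_, ?_⟩
  · have h1 : l * p ≤ l * (2 * ∑ i ∈ B, (m * x i) % p) := by
      have h2 : p * l ≤ p * (2 * (u * k)) := Nat.mul_le_mul_left _ (by omega)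
      nlinarith [Nat.zero_le (m * ∑ i ∈ B, (l * x i) % p)]
    exact Nat.le_of_mul_le_mul_left h1 (by omega)
  · rw [hsum]
    have h1 : p * (u * k) ≤ (l - 1) * p := by
      rw [mul_comm p]; exact Nat.mul_le_mul_right _ hku
    have h2 : m * (144 * ∑ i ∈ B, (l * x i) % p) ≤ m * ((l - 1) * p) :=
      Nat.mul_le_mul_left _ (hes.trans (Nat.mul_le_mul_right _ hkl))
    nlinarith

/-- The combinatorial heart. -/
lemma heart {ι : Type*} [DecidableEq ι] (p s : ℕ) (x : ι → ℕ) (G : Finset ι)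
    (hp : p.Prime) (hbig : 24318 < p) (h10 : p ≤ 10 * s + 2) (h2s : 2 * s < p)
    (hG : ∀ i ∈ G, s < x i ∧ x i + s < p) (hcard : p ≤ G.card + s)
    (hno : ∀ B ⊆ G, ∀ k, 1 ≤ k → k < p → ∀ t ≤ s, ∑ i ∈ B, (k * x i) % p + k * t ≠ p) :
    False := by
  classical
  have hodd : p % 2 = 1 := hp.eq_two_or_odd.resolve_left (by omega)
  have hs : p / 10 ≤ s := by omega
  have hassign : ∀ i, ∃ m, i ∈ G → 2 ≤ m ∧ m ≤ 9 ∧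
      (((m * x i) % p ≤ p / 10 ∧ Nat.Coprime (m * x i / p) m ∧ 1 ≤ m * x i / p ∧ m * x i / p < m) ∨
       (p ≤ (m * x i) % p + p / 10 ∧ Nat.Coprime (m * x i / p + 1) m ∧ m * x i / p + 1 < m)) := by
    intro i
    by_cases hi : i ∈ G
    · obtain ⟨m, hm⟩ := assign p s (x i) hp hbig hs (hG i hi).1 (hG i hi).2
      exact ⟨m, fun _ => hm⟩
    · exact ⟨0, fun h => absurd h hi⟩
  choose M hM using hassign
  have hcop : ∀ m, 1 ≤ m → m ≤ 9 → Nat.Coprime p m := fun m h1 h9 =>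
    (Nat.Prime.coprime_iff_not_dvd hp).2 (fun h => by have := Nat.le_of_dvd (by omega) h; omega)
  have hpos : ∀ i ∈ G, ∀ m, 1 ≤ m → m ≤ 9 → 1 ≤ (m * x i) % p := by
    intro i hi m h1 h9
    by_contra h
    have h : (m * x i) % p = 0 := by omega
    have h3 := (Nat.Coprime.dvd_of_dvd_mul_left (hcop m h1 h9) (Nat.dvd_of_mod_eq_zero h))
    have := hG i hi
    have := Nat.le_of_dvd (by omega) h3
    omega
  -- positive elements
  have hMpos : ∀ i ∈ G, (M i * x i) % p ≤ p / 10 →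
      Nat.Coprime (M i * x i / p) (M i) ∧ M i * x i / p < M i := by
    intro i hi h
    obtain ⟨h1, h2, h3 | h3⟩ := hM i hi
    · exact ⟨h3.2.1, h3.2.2.2⟩
    · omega
  have hMneg : ∀ i ∈ G, ¬ (M i * x i) % p ≤ p / 10 → p ≤ (M i * x i) % p + p / 10 ∧
      Nat.Coprime (M i * x i / p + 1) (M i) ∧ M i * x i / p < M i - 1 := by
    intro i hi h
    obtain ⟨h1, h2, h3 | h3⟩ := hM i hi
    · omega
    · exact ⟨h3.1, h3.2.1, by omega⟩
  -- negative classes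
  have hneg : ∀ m, 2 ≤ m → m ≤ 9 →
      (G.filter (fun i => M i = m ∧ ¬ (M i * x i) % p ≤ p / 10)).card ≤ 8 * (m - 1) := by
    intro m h2 h9
    have := Finset.card_le_mul_card_image_of_maps_to
      (s := G.filter (fun i => M i = m ∧ ¬ (M i * x i) % p ≤ p / 10))
      (t := Finset.range (m - 1)) (f := fun i => M i * x i / p) (n := 8) ?_ ?_
    · simpa using this
    · intro i hi
      rw [Finset.mem_filter] at hi
      obtain ⟨hi, rfl, hr⟩ := hi
      exact Finset.mem_range.2 (hMneg i hi hr).2.2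
    · intro c hc
      by_contra hcon
      obtain ⟨B, hB, hBc⟩ := Finset.exists_subset_card_eq (show m ≤ _ from
        le_trans h9 (Nat.succ_le_of_lt (Nat.lt_of_not_le hcon)))
      have hB' : ∀ i ∈ B, i ∈ G ∧ M i = m ∧ ¬ (M i * x i) % p ≤ p / 10 ∧ M i * x i / p = c := by
        intro i hi
        have := hB hi
        simp only [Finset.mem_filter] at this
        tauto
      obtain ⟨i0, hi0⟩ : B.Nonempty := by rw [← Finset.card_pos]; omega
      refine negclass p s m x G hp hbig hs hno h2 h9 c ?_ B (fun i hi => (hB' i hi).1) hBc ?_ ?_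
      · obtain ⟨a, b, e, f⟩ := hB' i0 hi0
        have := (hMneg i0 a e).2.1
        rwa [f, b] at this
      · intro i hi
        obtain ⟨a, b, e, f⟩ := hB' i hi
        rwa [b] at f
      · intro i hi
        obtain ⟨a, b, e, f⟩ := hB' i hi
        have := (hMneg i a e).1
        rwa [b] at this
  -- non-tiny positive elements
  have hnt : ∀ m, 2 ≤ m → m ≤ 9 →
      (G.filter (fun i => M i = m ∧ (M i * x i) % p ≤ p / 10 ∧ ¬ 144 * ((M i * x i) % p) < p)).card
        ≤ 152 := by
    intro m h2 h9
    by_contra hcon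
    set N := G.filter (fun i => M i = m ∧ (M i * x i) % p ≤ p / 10 ∧
      ¬ 144 * ((M i * x i) % p) < p) with hN
    have hN' : ∀ i ∈ N, i ∈ G ∧ M i = m ∧ (M i * x i) % p ≤ p / 10 ∧
      ¬ 144 * ((M i * x i) % p) < p := fun i hi => by simpa [hN] using hi
    obtain ⟨c, -, hc⟩ : ∃ c ∈ Finset.range m,
        7 < (N.filter (fun i => M i * x i / p = c)).card := by
      by_contra h
      push Not at h
      have := Finset.card_le_mul_card_image_of_maps_to
        (s := N) (t := Finset.range m) (f := fun i => M i * x i / p) (n := 7) ?_ h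
      · rw [Finset.card_range] at this; omega
      · intro i hi
        obtain ⟨a, b, e, f⟩ := hN' i hi
        have := (hMpos i a e).2
        exact Finset.mem_range.2 (by omega)
    obtain ⟨C, hC, hCc⟩ := Finset.exists_subset_card_eq (show m - 1 ≤ _ from
      le_trans (by omega) (Nat.succ_le_of_lt hc))
    have hCN : C ⊆ N := hC.trans (Finset.filter_subset _ _)
    have hNG : N ⊆ G := Finset.filter_subset _ _
    obtain ⟨i0, hi0⟩ : C.Nonempty := by rw [← Finset.card_pos]; omega
    have hNr : ∀ i ∈ N, (m * x i) % p ≤ p / 10 ∧ p ≤ 144 * ((m * x i) % p) := by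
      intro i hi
      obtain ⟨a, rfl, e, f⟩ := hN' i hi
      exact ⟨e, by omega⟩
    have hmm : (m - 1) * (p / 10) + p / 10 = m * (p / 10) := by
      obtain ⟨m', rfl⟩ : ∃ m', m = m' + 1 := ⟨m - 1, by omega⟩
      rw [Nat.add_sub_cancel]; ring
    have hm9 : m * (p / 10) ≤ 9 * (p / 10) := Nat.mul_le_mul_right _ h9
    have hms : m * (p / 10) ≤ m * s := Nat.mul_le_mul_left _ hs
    have key := fillA p s m x G hno (by omega) (by omega) ∅ (N \ C) C (by simp)
      (Finset.sdiff_subset.trans hNG) (hCN.trans hNG) (by simp) (by simp) Finset.sdiff_disjoint hCc c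
      (by
        have h := Finset.mem_filter.1 (hC hi0)
        obtain ⟨a, b, e, f⟩ := hN' i0 h.1
        have := (hMpos i0 a e).1
        rwa [h.2, b] at this)
      (hcop m (by omega) h9)
      (by
        intro i hi
        have h := Finset.mem_filter.1 (hC hi)
        obtain ⟨a, b, e, f⟩ := hN' i h.1
        have := h.2
        rwa [b] at this)
      ((m - 1) * (p / 10))
      (by
        have := Finset.sum_le_card_nsmul C (fun i => (m * x i) % p) (p / 10)
          (fun i hi => (hNr i (hCN hi)).1)
        rwa [hCc, smul_eq_mul] at this)
      (by rw [Finset.sum_empty]; omega)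
      (by
        intro i hi
        have := (hNr i (Finset.sdiff_subset hi)).1
        omega)
    have h1 : (N \ C).card • p ≤ ∑ i ∈ N \ C, 144 * ((m * x i) % p) :=
      Finset.card_nsmul_le_sum _ _ _ (fun i hi => (hNr i (Finset.sdiff_subset hi)).2)
    rw [← Finset.mul_sum, smul_eq_mul] at h1
    have h3 : 144 ≤ (N \ C).card := by
      rw [Finset.card_sdiff_of_subset hCN]; omega
    have h4 : 144 * p ≤ (N \ C).card * p := Nat.mul_le_mul_right _ h3
    omega
  -- tiny elements
  set T : ℕ → Finset ι := fun m => G.filter (fun i => M i = m ∧ 144 * ((M i * x i) % p) < p) with hT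
  set act : ℕ → Prop := fun m => ∃ c, 8 ≤ ((T m).filter (fun i => M i * x i / p = c)).card with hact
  have hT' : ∀ m, ∀ i ∈ T m, i ∈ G ∧ M i = m ∧ 144 * ((m * x i) % p) < p ∧
      Nat.Coprime (m * x i / p) m ∧ m * x i / p < m := by
    intro m i hi
    obtain ⟨h1, rfl, h3⟩ := Finset.mem_filter.1 hi
    exact ⟨h1, rfl, h3, hMpos i h1 (by omega)⟩
  have hinact : ∀ m, ¬ act m → (T m).card ≤ 7 * m := by
    intro m hm
    have := Finset.card_le_mul_card_image_of_maps_to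
        (s := T m) (t := Finset.range m) (f := fun i => M i * x i / p) (n := 7) ?_ ?_
    · rwa [Finset.card_range] at this
    · intro i hi
      obtain ⟨a, b, e, f⟩ := hT' m i hi
      rw [b]
      exact Finset.mem_range.2 f.2
    · intro c _
      by_contra h
      exact hm ⟨c, by omega⟩
  have hfiber : ∀ m, 2 ≤ m → m ≤ 9 →
      (G.filter (fun i => M i = m)).card ≤ (T m).card + 152 + 8 * (m - 1) := by
    intro m h2 h9
    have h1 : G.filter (fun i => M i = m) ⊆ (T m ∪
        G.filter (fun i => M i = m ∧ (M i * x i) % p ≤ p / 10 ∧ ¬ 144 * ((M i * x i) % p) < p)) ∪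
        G.filter (fun i => M i = m ∧ ¬ (M i * x i) % p ≤ p / 10) := by
      intro i hi
      simp only [hT, Finset.mem_union, Finset.mem_filter] at hi ⊢
      tauto
    have := (Finset.card_le_card h1).trans (Finset.card_union_le _ _)
    have h3 := Finset.card_union_le (T m)
      (G.filter (fun i => M i = m ∧ (M i * x i) % p ≤ p / 10 ∧ ¬ 144 * ((M i * x i) % p) < p))
    have := hneg m h2 h9
    have := hnt m h2 h9
    omega
  have hsumG : G.card = ∑ m ∈ Finset.Icc 2 9, (G.filter (fun i => M i = m)).card :=
    Finset.card_eq_sum_card_fiberwise (fun i hi => by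
      have := hM i hi
      exact Finset.mem_coe.2 (Finset.mem_Icc.2 ⟨this.1, this.2.1⟩))
  have hIcc : (Finset.Icc 2 9 : Finset ℕ) = {2, 3, 4, 5, 6, 7, 8, 9} := by decide
  -- a maximal active denominator is impossible
  have hC0 : ∀ m, 2 ≤ m → m ≤ 9 → act m → ∃ C ⊆ T m, C.card = m - 1 ∧
      144 * ∑ i ∈ C, (m * x i) % p ≤ (m - 1) * p ∧ ∃ c, Nat.Coprime c m ∧
      ∀ i ∈ C, m * x i / p = c := by
    rintro m h2 h9 ⟨c, hc⟩
    obtain ⟨C, hC, hCc⟩ := Finset.exists_subset_card_eq (show m - 1 ≤ _ from le_trans (by omega) hc)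
    have hCT : C ⊆ T m := hC.trans (Finset.filter_subset _ _)
    obtain ⟨i0, hi0⟩ : C.Nonempty := by rw [← Finset.card_pos]; omega
    have hCm : ∀ i ∈ C, m * x i / p = c := by
      intro i hi
      have h := Finset.mem_filter.1 (hC hi)
      have h3 := h.2
      rwa [(hT' m i h.1).2.1] at h3
    refine ⟨C, hCT, hCc, ?_, c, ?_, hCm⟩
    · rw [Finset.mul_sum, ← hCc, ← smul_eq_mul (a := C.card)]
      exact Finset.sum_le_card_nsmul C _ p (fun i hi => (hT' m i (hCT hi)).2.2.1.le)
    · have := (hT' m i0 (hCT hi0)).2.2.2.1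
      rwa [hCm i0 hi0] at this
  have hTG : ∀ m, T m ⊆ G := fun m => Finset.filter_subset _ _
  have hmax : ∀ m, 2 ≤ m → m ≤ 9 → act m → ∃ l, 2 ≤ l ∧ l ≤ 9 ∧ act l ∧ ¬ l ∣ m := by
    intro m h2 h9 hm
    by_contra hcon
    push Not at hcon
    obtain ⟨C, hCT, hCc, hCs, c, hcm, hCm⟩ := hC0 m h2 h9 hm
    set A := G.filter (fun i => act (M i) ∧ 144 * ((M i * x i) % p) < p) with hA
    have hAr : ∀ i ∈ A, 144 * ((m * x i) % p) ≤ m * p := by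
      intro i hi
      obtain ⟨hi, ha, hr⟩ := Finset.mem_filter.1 hi
      obtain ⟨l2, l9, -⟩ := hM i hi
      obtain ⟨g, hg⟩ := hcon (M i) l2 l9 ha
      have hgm : g ≤ m := by rw [hg]; exact Nat.le_mul_of_pos_left _ (by omega)
      have h1 : (m * x i) % p ≤ g * ((M i * x i) % p) := by
        have : m * x i = g * (M i * x i) := by rw [hg]; ring
        rw [this, ← Nat.mul_mod_mod]
        exact Nat.mod_le _ _
      calc 144 * ((m * x i) % p) ≤ g * (144 * ((M i * x i) % p)) := by nlinarith
        _ ≤ m * p := Nat.mul_le_mul hgm hr.le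
    have hms : m * p ≤ m * (10 * s + 2) := Nat.mul_le_mul_left _ h10
    have hm9 : m * p ≤ 9 * p := Nat.mul_le_mul_right _ h9
    have hmm : (m - 1) * p + p = m * p := by
      obtain ⟨m', rfl⟩ : ∃ m', m = m' + 1 := ⟨m - 1, by omega⟩
      rw [Nat.add_sub_cancel]; ring
    have hm1 : m * 1 ≤ m * s := Nat.mul_le_mul_left _ (by omega)
    have hm2 : 2 * s ≤ m * s := Nat.mul_le_mul_right _ h2
    have hms2 : m * (10 * s + 2) = 10 * (m * s) + 2 * m := by ring
    have key := fillA p s m x G hno (by omega) (by omega) ∅ (A \ C) C (by simp)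
      (Finset.sdiff_subset.trans (Finset.filter_subset _ _)) (hCT.trans (hTG m)) (by simp) (by simp)
      Finset.sdiff_disjoint hCc c hcm (hcop m (by omega) h9) hCm _ le_rfl
      (by rw [Finset.sum_empty]; omega)
      (by
        intro i hi
        have := hAr i (Finset.sdiff_subset hi)
        omega)
    have h1 : (A \ C).card • 1 ≤ ∑ i ∈ A \ C, (m * x i) % p :=
      Finset.card_nsmul_le_sum _ _ _ (fun i hi => hpos i
        (Finset.filter_subset _ _ (Finset.sdiff_subset hi)) m (by omega) h9)
    have h3 := Finset.le_card_sdiff C A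
    have h4 : A.card = ∑ m ∈ Finset.Icc 2 9, (A.filter (fun i => M i = m)).card :=
      Finset.card_eq_sum_card_fiberwise (fun i hi => by
        have := hM i (Finset.filter_subset _ _ hi)
        exact Finset.mem_coe.2 (Finset.mem_Icc.2 ⟨this.1, this.2.1⟩))
    have h5 : ∀ l, 2 ≤ l → l ≤ 9 → (G.filter (fun i => M i = l)).card ≤
        (A.filter (fun i => M i = l)).card + 152 + 8 * (l - 1) + 7 * l := by
      intro l l2 l9
      have h6 := hfiber l l2 l9
      by_cases hl : act l
      · have : T l ⊆ A.filter (fun i => M i = l) := by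
          intro i hi
          obtain ⟨a, b, e, -⟩ := hT' l i hi
          simp only [hA, Finset.mem_filter]
          rw [b]
          exact ⟨⟨a, hl, e⟩, rfl⟩
        have := Finset.card_le_card this
        omega
      · have := hinact l hl
        omega
    rw [hIcc] at hsumG h4
    simp only [Finset.sum_insert, Finset.mem_insert, Finset.mem_singleton, Finset.sum_singleton,
      Nat.reduceEqDiff, or_self, not_false_eq_true] at hsumG h4
    have f2 := h5 2 (by omega) (by omega)
    have f3 := h5 3 (by omega) (by omega)
    have f4 := h5 4 (by omega) (by omega)
    have f5 := h5 5 (by omega) (by omega)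
    have f6 := h5 6 (by omega) (by omega)
    have f7 := h5 7 (by omega) (by omega)
    have f8 := h5 8 (by omega) (by omega)
    have f9 := h5 9 (by omega) (by omega)
    rw [Finset.sum_empty] at key
    rw [smul_eq_mul] at h1
    omega
  have hact2 : ∀ m, 2 ≤ m → m ≤ 9 → (T m).card ≤ 7 * m ∨ 2 * (T m).card + 2 * (m * s) ≤ p + 16 := by
    intro m h2 h9
    by_cases hm : act m
    swap
    · exact Or.inl (hinact m hm)
    right
    obtain ⟨l, l2, l9, ⟨d, hd⟩, hlm⟩ := hmax m h2 h9 hm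
    obtain ⟨C, hCT, hCc, hCs, c, hcm, hCm⟩ := hC0 m h2 h9 hm
    set D := (T l).filter (fun i => M i * x i / p = d) with hD
    have hD' : ∀ i ∈ D, i ∈ T l ∧ l * x i / p = d := by
      intro i hi
      obtain ⟨h1, h3⟩ := Finset.mem_filter.1 hi
      rw [(hT' l i h1).2.1] at h3
      exact ⟨h1, h3⟩
    obtain ⟨i0, hi0⟩ : D.Nonempty := by rw [← Finset.card_pos]; omega
    obtain ⟨B, hBD, hB1, hB2⟩ := vbuild p m l x hp h9 l2 l9 hlm d
      (by
        obtain ⟨h1, h3⟩ := hD' i0 hi0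
        have := (hT' l i0 h1).2.2.2.1
        rwa [h3] at this) D hd (fun i hi => (hD' i hi).2)
        (fun i hi => (hT' l i (hD' i hi).1).2.2.1)
    have hBT : B ⊆ T l := fun i hi => (hD' i (hBD hi)).1
    have hdisj : Disjoint (T l) (T m) := by
      rw [Finset.disjoint_left]
      intro i h1 h3
      have e1 := (hT' l i h1).2.1
      have e2 := (hT' m i h3).2.1
      exact hlm (by rw [← e1, ← e2])
    have hms : m * p ≤ m * (10 * s + 2) := Nat.mul_le_mul_left _ h10
    have hm9 : m * p ≤ 9 * p := Nat.mul_le_mul_right _ h9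
    have hmm : (m - 1) * p + p = m * p := by
      obtain ⟨m', rfl⟩ : ∃ m', m = m' + 1 := ⟨m - 1, by omega⟩
      rw [Nat.add_sub_cancel]; ring
    have hm1 : m * 1 ≤ m * s := Nat.mul_le_mul_left _ (by omega)
    have hm2 : 2 * p ≤ m * p := Nat.mul_le_mul_right _ h2
    have hms2 : m * (10 * s + 2) = 10 * (m * s) + 2 * m := by ring
    have hBC : ∑ i ∈ B, (m * x i) % p + ∑ i ∈ C, (m * x i) % p ≤ p := by
      generalize (∑ i ∈ B, (m * x i) % p) = V at *
      generalize (∑ i ∈ C, (m * x i) % p) = W at *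
      clear hms hm9 hmm hm1 hm2 hms2
      interval_cases m <;> interval_cases l <;> omega
    have key := fillA p s m x G hno (by omega) (by omega) B (T m \ C) C (hBT.trans (hTG l))
      (Finset.sdiff_subset.trans (hTG m)) (hCT.trans (hTG m))
      (Finset.disjoint_of_subset_left hBT (Finset.disjoint_of_subset_right Finset.sdiff_subset hdisj))
      (Finset.disjoint_of_subset_left hBT (Finset.disjoint_of_subset_right hCT hdisj))
      Finset.sdiff_disjoint hCc c hcm (hcop m (by omega) h9) hCm _ le_rfl hBC
      (by
        intro i hi
        have := (hT' m i (Finset.sdiff_subset hi)).2.2.1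
        omega)
    have h1 : (T m \ C).card • 1 ≤ ∑ i ∈ T m \ C, (m * x i) % p :=
      Finset.card_nsmul_le_sum _ _ _ (fun i hi => hpos i
        (hTG m (Finset.sdiff_subset hi)) m (by omega) h9)
    have h3 := Finset.le_card_sdiff C (T m)
    rw [smul_eq_mul] at h1
    omega
  rw [hIcc] at hsumG
  simp only [Finset.sum_insert, Finset.mem_insert, Finset.mem_singleton, Finset.sum_singleton,
    Nat.reduceEqDiff, or_self, not_false_eq_true] at hsumG
  have f2 := hfiber 2 (by omega) (by omega)
  have f3 := hfiber 3 (by omega) (by omega)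
  have f4 := hfiber 4 (by omega) (by omega)
  have f5 := hfiber 5 (by omega) (by omega)
  have f6 := hfiber 6 (by omega) (by omega)
  have f7 := hfiber 7 (by omega) (by omega)
  have f8 := hfiber 8 (by omega) (by omega)
  have f9 := hfiber 9 (by omega) (by omega)
  have g2 := hact2 2 (by omega) (by omega)
  have g3 := hact2 3 (by omega) (by omega)
  have g4 := hact2 4 (by omega) (by omega)
  have g5 : (T 5).card ≤ 63 := by have := hact2 5 (by omega) (by omega); omega
  have g6 : (T 6).card ≤ 63 := by have := hact2 6 (by omega) (by omega); omega
  have g7 : (T 7).card ≤ 63 := by have := hact2 7 (by omega) (by omega); omega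
  have g8 : (T 8).card ≤ 63 := by have := hact2 8 (by omega) (by omega); omega
  have g9 : (T 9).card ≤ 63 := by have := hact2 9 (by omega) (by omega); omega
  rcases g2 with g2 | g2 <;> rcases g3 with g3 | g3 <;> rcases g4 with g4 | g4 <;> omega

/-- The core statement in terms of natural number representatives. -/
lemma core {ι : Type*} [DecidableEq ι] [Fintype ι] (p : ℕ) (x : ι → ℕ)
    (hp : p.Prime) (hbig : 24318 < p) (hx : ∀ i, 1 ≤ x i ∧ x i < p)
    (hcard : p ≤ Fintype.card ι)
    (hones : p ≤ 10 * (Finset.univ.filter (fun i => x i = 1)).card + 2) :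
    ∃ T : Finset ι, ∃ m, 1 ≤ m ∧ m < p ∧ ∑ i ∈ T, (m * x i) % p = p := by
  classical
  by_contra hcon
  push Not at hcon
  set O := Finset.univ.filter (fun i => x i = 1) with hO
  let good : Finset ι → Prop := fun A => O ⊆ A ∧ ∀ t ≤ ∑ i ∈ A, x i, ∃ B ⊆ A, ∑ i ∈ B, x i = t
  have hOgood : good O := by
    refine ⟨le_refl _, fun t ht => ?_⟩
    have h1 : ∀ B ⊆ O, ∑ i ∈ B, x i = B.card := by
      intro B hB
      rw [Finset.sum_congr rfl (fun i hi => (Finset.mem_filter.1 (hB hi)).2)]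
      simp
    rw [h1 O le_rfl] at ht
    obtain ⟨B, hB, hBc⟩ := Finset.exists_subset_card_eq ht
    exact ⟨B, hB, by rw [h1 B hB, hBc]⟩
  obtain ⟨A, hA, hAmax⟩ := Finset.exists_max_image (Finset.univ.filter good) Finset.card
    ⟨O, by simpa using hOgood⟩
  obtain ⟨-, hOA, hAt⟩ := Finset.mem_filter.1 hA
  set s := ∑ i ∈ A, x i with hs
  have hp1 := hp.one_lt
  -- general principle
  have hno : ∀ B ⊆ Aᶜ, ∀ k, 1 ≤ k → k < p → ∀ t ≤ s, ∑ i ∈ B, (k * x i) % p + k * t ≠ p := by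
    intro B hB k hk1 hkp t ht heq
    obtain ⟨A', hA', hA't⟩ := hAt t ht
    refine hcon (B ∪ A') k hk1 hkp ?_
    rw [Finset.sum_union]
    · refine Eq.trans ?_ heq
      congr 1
      rw [← hA't, Finset.mul_sum]
      apply Finset.sum_congr rfl
      intro i hi
      have h1 : x i ≤ t := by
        rw [← hA't]; exact Finset.single_le_sum (fun _ _ => Nat.zero_le _) hi
      have h2 : k * x i ≤ k * t := Nat.mul_le_mul_left _ h1
      have h3 : k * x i ≠ p := by
        intro h
        have h4 : p ∣ k * x i := by rw [h]
        rcases (Nat.Prime.dvd_mul hp).1 h4 with h5 | h5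
        · have := Nat.le_of_dvd (by omega) h5; omega
        · have := Nat.le_of_dvd (by have := hx i; omega) h5
          have := hx i; omega
      have hle : k * x i ≤ p := by omega
      exact Nat.mod_eq_of_lt (lt_of_le_of_ne hle h3)
    · rw [Finset.disjoint_left]
      intro i h1 h2
      exact (Finset.mem_compl.1 (hB h1)) (hA' h2)
  have hsp : s < p := by
    by_contra h
    exact hno ∅ (by simp) 1 le_rfl hp1 p (by omega) (by simp)
  have hG2 : ∀ i ∈ Aᶜ, x i + s < p := by
    intro i hi
    by_contra h
    have := hx i
    refine hno {i} (by simpa using hi) 1 le_rfl hp1 (p - x i) (by omega) ?_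
    rw [Finset.sum_singleton, one_mul, one_mul, Nat.mod_eq_of_lt this.2]
    omega
  have hG1 : ∀ i ∈ Aᶜ, s < x i := by
    intro i hi
    by_contra h
    have hiA := Finset.mem_compl.1 hi
    have hg : good (insert i A) := by
      refine ⟨hOA.trans (Finset.subset_insert _ _), fun t ht => ?_⟩
      rw [Finset.sum_insert hiA] at ht
      by_cases hts : t ≤ s
      · obtain ⟨B, hB, hBt⟩ := hAt t hts
        exact ⟨B, hB.trans (Finset.subset_insert _ _), hBt⟩
      · obtain ⟨B, hB, hBt⟩ := hAt (t - x i) (by omega)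
        refine ⟨insert i B, Finset.insert_subset_insert _ hB, ?_⟩
        rw [Finset.sum_insert (fun h => hiA (hB h)), hBt]
        omega
    have := hAmax _ (Finset.mem_filter.2 ⟨Finset.mem_univ _, hg⟩)
    rw [Finset.card_insert_of_notMem hiA] at this
    omega
  have hAs : A.card ≤ s := by
    have := Finset.card_nsmul_le_sum A x 1 (fun i _ => (hx i).1)
    simpa using this
  have hOs := Finset.card_le_card hOA
  have hcc := Finset.card_compl_add_card A
  obtain ⟨i0, hi0⟩ : (Aᶜ).Nonempty := by rw [← Finset.card_pos]; omega
  have := hG1 i0 hi0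
  have := hG2 i0 hi0
  exact heart p s x Aᶜ hp hbig (by omega) (by omega) (fun i hi => ⟨hG1 i hi, hG2 i hi⟩)
    (by omega) hno

/-- Theorem 1.5: if `p > 24318` is a prime and `S` is a sequence of `p` nonzero
elements of `ℤ/pℤ` with `h(S) ≥ (p-2)/10`, then `S` contains a nonempty
subsequence with index `p`. -/
theorem stmt_1 (p : ℕ) (hp : p.Prime) (hbig : 24318 < p)
    (S : Multiset (ZMod p)) (hcard : Multiset.card S = p)
    (h0 : (0 : ZMod p) ∉ S)
    (hrep : ((p : ℚ) - 2) / 10 ≤ (maxRep S : ℚ)) :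
    ∃ T ≤ S, T ≠ 0 ∧ ∃ m : ℤ, IsCoprime m (p : ℤ) ∧ sigmaM p m T = p := by
  classical
  have : Fact p.Prime := ⟨hp⟩
  have hSne : S.toFinset.Nonempty := by
    rw [Finset.nonempty_iff_ne_empty, Ne, Multiset.toFinset_eq_empty]
    rintro rfl
    rw [Multiset.card_zero] at hcard
    omega
  obtain ⟨g, hg, hgc⟩ := Finset.exists_mem_eq_sup S.toFinset hSne (fun a => S.count a)
  have hgS : g ∈ S := Multiset.mem_toFinset.1 hg
  have hg0 : g ≠ 0 := fun h => h0 (h ▸ hgS)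
  have hcount : p ≤ 10 * S.count g + 2 := by
    have h1 : maxRep S = S.count g := by unfold maxRep; convert hgc
    rw [h1] at hrep
    have : (p : ℚ) ≤ 10 * (S.count g : ℚ) + 2 := by linarith
    exact_mod_cast this
  obtain ⟨l, rfl⟩ : ∃ l : List (ZMod p), S = (l : Multiset (ZMod p)) := ⟨S.toList, by simp⟩
  have hlen : l.length = p := by simpa using hcard
  have hne : ∀ i : Fin l.length, l.get i ≠ 0 := by
    intro i h
    apply h0
    rw [← h]
    exact Multiset.mem_coe.2 (List.get_mem l i)
  have hmap : (Finset.univ : Finset (Fin l.length)).val.map l.get = (l : Multiset (ZMod p)) := by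
    rw [Fin.univ_val_map, List.ofFn_get]
  obtain ⟨T, m, hm1, hmp, hT⟩ := core (ι := Fin l.length) p (fun i => (g⁻¹ * l.get i).val) hp hbig
    (by
      intro i
      refine ⟨?_, ZMod.val_lt _⟩
      rw [Nat.one_le_iff_ne_zero, Ne, ZMod.val_eq_zero]
      exact mul_ne_zero (inv_ne_zero hg0) (hne i))
    (by simp [hlen])
    (by
      have : (Finset.univ.filter (fun i : Fin l.length => (g⁻¹ * l.get i).val = 1)).card
          = Multiset.count g (l : Multiset (ZMod p)) := by
        rw [← hmap, Multiset.count_map, Finset.card_def, Finset.filter_val]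
        congr 1
        apply Multiset.filter_congr
        intro i _
        rw [ZMod.val_eq_one hp.one_lt, inv_mul_eq_one₀ hg0]
      rw [this]
      exact hcount)
  have hTne : T.val.map l.get ≠ 0 := by
    rw [Ne, Multiset.map_eq_zero, Finset.val_eq_zero]
    rintro rfl
    rw [Finset.sum_empty] at hT
    omega
  refine ⟨T.val.map l.get, ?_, hTne, ((m : ZMod p) * g⁻¹).val, ?_, ?_⟩
  · rw [← hmap]
    exact Multiset.map_le_map (Finset.val_le_iff.2 (Finset.subset_univ T))
  · have hm0 : (m : ZMod p) ≠ 0 := by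
      rw [Ne, ZMod.natCast_eq_zero_iff]
      intro h
      have := Nat.le_of_dvd (by omega) h
      omega
    rw [Nat.isCoprime_iff_coprime]
    have := (ZMod.isUnit_iff_coprime ((m : ZMod p) * g⁻¹).val p).1 (by
      rw [ZMod.natCast_val, ZMod.cast_id', id]
      exact (mul_ne_zero hm0 (inv_ne_zero hg0)).isUnit)
    exact this
  · unfold sigmaM
    rw [Multiset.map_map]
    refine Eq.trans ?_ hT
    rw [Finset.sum]
    congr 1
    apply Multiset.map_congr rfl
    intro i _
    have hm0 : (m : ZMod p) ≠ 0 := by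
      rw [Ne, ZMod.natCast_eq_zero_iff]
      intro h
      have := Nat.le_of_dvd (by omega) h
      omega
    have e1 : ((((m : ZMod p) * g⁻¹).val : ℤ) • l.get i : ZMod p)
        = ((m * (g⁻¹ * l.get i).val : ℕ) : ZMod p) := by
      rw [zsmul_eq_mul]
      push_cast
      rw [ZMod.natCast_val, ZMod.cast_id', id, ZMod.natCast_val, ZMod.cast_id', id]
      ring
    have e2 : ((m * (g⁻¹ * l.get i).val : ℕ) : ZMod p) ≠ 0 := by
      push_cast
      rw [ZMod.natCast_val, ZMod.cast_id', id]
      exact mul_ne_zero hm0 (mul_ne_zero (inv_ne_zero hg0) (hne i))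
    simp only [Function.comp]
    rw [e1, nval, if_neg e2, ZMod.val_natCast]
end

section
/- Let k ≥ 5 be a natural number and n = 4k+2. Let S be the sequence over ℤ/nℤ consisting of the element 1 repeated n/2 − 3 times, the element n/2 once, the element n/2 + 1 repeated n/2 − 1 times, and the element n/2 + 2 repeated ⌊n/4⌋ − 2 times. Then no nonempty subsequence T of S has index n; that is, there is no nonempty subsequence T of S and integer j coprime to n with σ(|jT|_n) = n. (In particular S has length n + ⌊n/4⌋ − 5 and disproves the Lemke–Kleitman conjecture.) -/
theorem nval_eq_of (n : ℕ) (x : ZMod n) (r : ℤ) (h0 : 0 < r) (h1 : r < n)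
    (hx : x = (r : ZMod n)) : (nval n x : ℤ) = r := by
  lift r to ℕ using h0.le
  have hr : (r : ZMod n).val = r := ZMod.val_cast_of_lt (by exact_mod_cast h1)
  have hne : x ≠ 0 := by
    intro h
    rw [hx] at h
    have h2 : (r : ZMod n).val = 0 := by
      rw [ZMod.val_eq_zero]; simpa using h
    omega
  unfold nval
  rw [if_neg hne, hx]
  simp [hr]

/-- The key divisibility step in the ranges where the last term has wrapped around. -/
theorem key_wrap (k h i a e b c : ℤ) (hh : h = 2 * k + 1) (hcop : IsCoprime i h)
    (hi : k < i) (hi2 : i < h) (ha : 0 ≤ a) (he : 0 ≤ e) (he1 : e ≤ 1) (hb : 0 ≤ b)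
    (hc : 0 ≤ c) (hck : c ≤ k - 2)
    (hs : a * i + e * h + b * (h + i) + c * (2 * i - h) = 2 * h) : False := by
  have hk : 0 < i := by omega
  have h1 : 0 ≤ a * i := by positivity
  have h2 : 0 ≤ e * h := mul_nonneg he (by omega)
  have h4 : 0 ≤ c * (2 * i - h) := mul_nonneg hc (by omega)
  have hb1 : b ≤ 1 := by
    by_contra hb2
    have : 2 * (h + i) ≤ b * (h + i) := mul_le_mul_of_nonneg_right (by omega) (by omega)
    omega
  have hd : i ∣ h * (c + 2 - e - b) := ⟨a + b + 2 * c, by linear_combination -hs⟩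
  have hd2 := hcop.dvd_of_dvd_mul_left hd
  have h0 : c + 2 - e - b = 0 := Int.eq_zero_of_dvd_of_nonneg_of_lt (by omega) (by omega) hd2
  obtain rfl : e = 1 := by omega
  obtain rfl : b = 1 := by omega
  omega

theorem key_A (k h j a e b c : ℤ) (hk : 5 ≤ k) (hh : h = 2 * k + 1) (hcop : IsCoprime j h)
    (hodd : j % 2 = 1)
    (hi : 0 < j) (ha : 0 ≤ a) (hak : a ≤ h - 3) (he : 0 ≤ e) (he1 : e ≤ 1)
    (hb : 0 ≤ b) (hc : 0 ≤ c)
    (hs : a * j + e * h + b * (h + j) + c * (h + 2 * j) = 2 * h) : False := by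
  have h1 : 0 ≤ a * j := by positivity
  have h3 : 0 ≤ b * j := by positivity
  have h4 : 0 ≤ c * j := by positivity
  have hle : e + b + c ≤ 2 := by
    by_contra hlt
    have : 3 * h ≤ (e + b + c) * h := mul_le_mul_of_nonneg_right (by omega) (by omega)
    nlinarith
  have hd : j ∣ h * (2 - e - b - c) := ⟨a + b + 2 * c, by linear_combination -hs⟩
  have hd2 := hcop.dvd_of_dvd_mul_left hd
  have hj1 : j = 1 ∨ e + b + c = 2 := by
    by_cases h2 : e + b + c = 2
    · exact Or.inr h2
    · left
      have := Int.le_of_dvd (by omega) hd2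
      omega
  rcases hj1 with rfl | h2
  · have hb2 : b ≤ 2 := by omega
    have hc2 : c ≤ 2 := by omega
    interval_cases e <;> interval_cases b <;> interval_cases c <;> omega
  · have hb2 : b ≤ 2 := by omega
    have hc2 : c ≤ 2 := by omega
    interval_cases e <;> interval_cases b <;> interval_cases c <;> omega

theorem key_C (k h i a e b c : ℤ) (hk : 5 ≤ k) (hh : h = 2 * k + 1) (hcop : IsCoprime i h)
    (hi : 2 ≤ i) (ha : 0 ≤ a) (he : 0 ≤ e) (he1 : e ≤ 1)
    (hb : 0 ≤ b) (hbk : b ≤ h - 1) (hc : 0 ≤ c)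
    (hs : a * (h + i) + e * h + b * i + c * (h + 2 * i) = 2 * h) : False := by
  have h1 : 0 ≤ a * i := by positivity
  have h3 : 0 ≤ b * i := by positivity
  have h4 : 0 ≤ c * i := by positivity
  have hle : e + a + c ≤ 2 := by
    by_contra hlt
    have : 3 * h ≤ (e + a + c) * h := mul_le_mul_of_nonneg_right (by omega) (by omega)
    nlinarith
  have hd : i ∣ h * (2 - e - a - c) := ⟨a + b + 2 * c, by linear_combination -hs⟩
  have hd2 := hcop.dvd_of_dvd_mul_left hd
  have hj1 : (i = 2 ∧ e + a + c = 0) ∨ e + a + c = 2 := by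
    by_cases h2 : e + a + c = 2
    · exact Or.inr h2
    · left
      have := Int.le_of_dvd (by omega) hd2
      omega
  have ha2 : a ≤ 2 := by omega
  have hc2 : c ≤ 2 := by omega
  rcases hj1 with ⟨rfl, h0⟩ | h2
  · interval_cases e <;> interval_cases a <;> interval_cases c <;> omega
  · interval_cases e <;> interval_cases a <;> interval_cases c <;> omega

theorem le_add_split {α : Type*} [DecidableEq α] {T A B : Multiset α} (h : T ≤ A + B) :
    ∃ T1 T2, T1 ≤ A ∧ T2 ≤ B ∧ T = T1 + T2 :=
  ⟨T - B, T ∩ B, by rwa [tsub_le_iff_right], Multiset.inter_le_right,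
    (Multiset.sub_add_inter T B).symm⟩

/-- Theorem 1.6 (counterexample to the Lemke–Kleitman conjecture): for `n = 4k+2`
with `k ≥ 5`, the sequence `1^(n/2-3) (n/2) (n/2+1)^(n/2-1) (n/2+2)^(⌊n/4⌋-2)`
over `ℤ/nℤ` contains no nonempty subsequence with index `n`. -/
theorem stmt_2 (k : ℕ) (hk : 5 ≤ k) (n : ℕ) (hn : n = 4 * k + 2)
    (S : Multiset (ZMod n))
    (hS : S = Multiset.replicate (n / 2 - 3) (1 : ZMod n)
        + {((n / 2 : ℕ) : ZMod n)}
        + Multiset.replicate (n / 2 - 1) ((n / 2 + 1 : ℕ) : ZMod n)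
        + Multiset.replicate (n / 4 - 2) ((n / 2 + 2 : ℕ) : ZMod n)) :
    ¬ ∃ T ≤ S, T ≠ 0 ∧ ∃ j : ℤ, IsCoprime j (n : ℤ) ∧ sigmaM n j T = n := by
  rintro ⟨T, hTS, -, j, hj, hsum⟩
  rw [hS] at hTS
  obtain ⟨T', T4, hT', hT4, rfl⟩ := le_add_split hTS
  obtain ⟨T'', T3, hT'', hT3, rfl⟩ := le_add_split hT'
  obtain ⟨T1, T2, hT1, hT2, rfl⟩ := le_add_split hT''
  rw [← Multiset.replicate_one] at hT2
  rw [Multiset.le_replicate_iff] at hT1 hT2 hT3 hT4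
  obtain ⟨a, ha, rfl⟩ := hT1
  obtain ⟨e, he, rfl⟩ := hT2
  obtain ⟨b, hb, rfl⟩ := hT3
  obtain ⟨c, hc, rfl⟩ := hT4
  have hh2 : n / 2 = 2 * k + 1 := by omega
  have hh4 : n / 4 = k := by omega
  rw [hh2] at ha hb hsum
  rw [hh4] at hc
  simp only [sigmaM, Multiset.map_add, Multiset.map_replicate, Multiset.sum_add,
    Multiset.sum_replicate, smul_eq_mul] at hsum
  have hs : (a : ℤ) * nval n (j • (1 : ZMod n))
      + e * nval n (j • ((2 * k + 1 : ℕ) : ZMod n))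
      + b * nval n (j • ((2 * k + 1 + 1 : ℕ) : ZMod n))
      + c * nval n (j • ((2 * k + 1 + 2 : ℕ) : ZMod n)) = n := by exact_mod_cast hsum
  clear hsum hS hTS hT' hT''
  obtain ⟨h, hh⟩ : ∃ h : ℤ, h = 2 * k + 1 := ⟨_, rfl⟩
  have hnh : (n : ℤ) = 2 * h := by rw [hn, hh]; push_cast; ring
  have hz : (2 * h : ZMod n) = 0 := by
    have : ((n : ℤ) : ZMod n) = 0 := by simp
    rw [hnh] at this
    exact_mod_cast this
  have hkh : (2 * (k : ZMod n) + 1) = h := by rw [hh]; push_cast; ring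
  have hzk : (2 * (2 * k + 1) : ZMod n) = 0 := by rw [hkh]; exact hz
  -- reduce j
  obtain ⟨q, r, hjr, hr0, hrn⟩ : ∃ q r : ℤ, j = r + (n : ℤ) * q ∧ 0 ≤ r ∧ r < n :=
    ⟨j / n, j % n, (Int.emod_add_mul_ediv j n).symm, Int.emod_nonneg _ (by omega),
      Int.emod_lt_of_pos _ (by omega)⟩
  have hrc : IsCoprime r (n : ℤ) := by
    rw [hjr] at hj
    exact IsCoprime.of_add_mul_left_left hj
  have hjz : (j : ZMod n) = r := by rw [hjr]; simp
  rw [hnh] at hrc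
  have hr2 : IsCoprime r 2 := hrc.of_mul_right_left
  have hrh : IsCoprime r h := hrc.of_mul_right_right
  have hodd : r % 2 = 1 := by
    obtain ⟨u, v, huv⟩ := hr2
    rcases Int.emod_two_eq_zero_or_one r with h0 | h0
    · exfalso
      obtain ⟨w, hw⟩ := Int.dvd_of_emod_eq_zero h0
      have : 2 * (u * w + v) = 1 := by rw [hw] at huv; linarith
      omega
    · exact h0
  have hrneh : r ≠ h := by
    rintro rfl
    rw [isCoprime_self, Int.isUnit_iff] at hrh
    omega
  obtain ⟨s, hrs⟩ : ∃ s : ℤ, r = 2 * s + 1 := ⟨r / 2, by omega⟩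
  have hjs : (j : ZMod n) = 2 * s + 1 := by rw [hjz, hrs]; push_cast; ring
  simp only [zsmul_eq_mul, hjs] at hs
  have e2 := nval_eq_of n ((2 * s + 1) * ((2 * k + 1 : ℕ) : ZMod n)) h (by omega) (by omega)
    (by rw [hh]; push_cast; linear_combination (s : ZMod n) * hzk)
  have e1 := nval_eq_of n ((2 * s + 1) * (1 : ZMod n)) r (by omega) (by omega)
    (by rw [hrs]; push_cast; ring)
  rw [e1, e2] at hs
  have ha' : (a : ℤ) ≤ h - 3 := by omega
  have hb' : (b : ℤ) ≤ h - 1 := by omega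
  have hc' : (c : ℤ) ≤ k - 2 := by omega
  have he' : (e : ℤ) ≤ 1 := by omega
  have hk' : (5 : ℤ) ≤ k := by omega
  rcases lt_or_gt_of_ne hrneh with hlt | hgt
  · have e3 := nval_eq_of n ((2 * s + 1) * ((2 * k + 1 + 1 : ℕ) : ZMod n)) (h + r) (by omega)
      (by omega) (by rw [hh, hrs]; push_cast; linear_combination (s : ZMod n) * hzk)
    rw [e3] at hs
    by_cases hrk : r ≤ k
    · have e4 := nval_eq_of n ((2 * s + 1) * ((2 * k + 1 + 2 : ℕ) : ZMod n)) (h + 2 * r)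
        (by omega) (by omega)
        (by rw [hh, hrs]; push_cast; linear_combination (s : ZMod n) * hzk)
      rw [e4] at hs
      exact key_A k h r a e b c hk' hh hrh hodd (by omega) (by omega) ha' (by omega) he'
        (by omega) (by omega) (by linarith)
    · have e4 := nval_eq_of n ((2 * s + 1) * ((2 * k + 1 + 2 : ℕ) : ZMod n)) (2 * r - h)
        (by omega) (by omega)
        (by rw [hh, hrs]; push_cast; linear_combination (s + 1 : ZMod n) * hzk)
      rw [e4] at hs
      exact key_wrap k h r a e b c hh hrh (by omega) (by omega) (by omega) (by omega) he'
        (by omega) (by omega) hc' (by linarith)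
  · obtain ⟨i, hi⟩ : ∃ i : ℤ, r = h + i := ⟨r - h, by ring⟩
    have hih : IsCoprime i h := by
      rw [hi] at hrh
      have : IsCoprime (i + h * 1) h := by convert hrh using 1; ring
      exact IsCoprime.of_add_mul_left_left this
    have hiz : (i : ZMod n) = 2 * s + 1 - (2 * k + 1) := by
      have : i = 2 * s + 1 - (2 * k + 1) := by omega
      rw [this]; push_cast; ring
    have e3 := nval_eq_of n ((2 * s + 1) * ((2 * k + 1 + 1 : ℕ) : ZMod n)) i (by omega)
      (by omega) (by rw [hiz]; push_cast; linear_combination (s + 1 : ZMod n) * hzk)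
    rw [e3] at hs
    by_cases hrk : i ≤ k
    · have e4 := nval_eq_of n ((2 * s + 1) * ((2 * k + 1 + 2 : ℕ) : ZMod n)) (h + 2 * i)
        (by omega) (by omega)
        (by push_cast; rw [hiz, ← hkh]; linear_combination (s + 1 : ZMod n) * hzk)
      rw [e4, hi] at hs
      exact key_C k h i a e b c hk' hh hih (by omega) (by omega) (by omega) he'
        (by omega) hb' (by omega) (by linarith)
    · have e4 := nval_eq_of n ((2 * s + 1) * ((2 * k + 1 + 2 : ℕ) : ZMod n)) (2 * i - h)
        (by omega) (by omega)
        (by push_cast; rw [hiz, ← hkh]; linear_combination (s + 2 : ZMod n) * hzk)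
      rw [e4, hi] at hs
      exact key_wrap k h i b e a c hh hih (by omega) (by omega) (by omega) (by omega) he'
        (by omega) (by omega) hc' (by linarith)
end

section
/- Let p be a prime and let S be a minimal zero-sum sequence of 4 elements of ℤ/pℤ (the sum of the terms of S is 0 in ℤ/pℤ and no proper nonempty subsequence of S has sum 0). Then Index(S) = p; that is, there exists an integer m coprime to p with σ(|mS|_p) = p. -/
lemma four_bound {u v n : ℝ} {s : ℝ} (hn : 1 ≤ n) (hu : n ≤ u) (hu' : u ≤ n+1) (hv : n ≤ v) (hv' : v ≤ n+1) (hs : 1 ≤ s) (hs2 : s ≤ 2) :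
   |1 / u ^ s - 1 / v ^ s| ≤ 2 / n ^ 2 := by
  have n0 : 0 < n := by linarith
  have key : 1 / n ^ s - 1 / (n+1) ^ s ≤ 2 / n ^ 2 := by
    have h1 : 1 / n ^ s - 1 / (n+1) ^ s = (1/n^s) * (1 - (n/(n+1))^s) := by
      rw [Real.div_rpow n0.le (by linarith)]
      have : n ^ s ≠ 0 := (Real.rpow_pos_of_pos n0 s).ne'
      have : (n+1) ^ s ≠ 0 := (Real.rpow_pos_of_pos (by linarith) s).ne'
      field_simp
    have h2 : (n/(n+1))^(2:ℝ) ≤ (n/(n+1))^s :=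
      Real.rpow_le_rpow_of_exponent_ge (by positivity) (by rw [div_le_one (by linarith)]; linarith) hs2
    have h3 : 1 / n^s ≤ 1 / n := by
      apply one_div_le_one_div_of_le n0
      simpa using Real.rpow_le_rpow_of_exponent_le hn hs
    have h4 : 1 - (n/(n+1))^(2:ℝ) ≤ 2 / n := by
      rw [Real.rpow_two, show 1 - (n / (n+1))^2 = (2*n+1)/(n+1)^2 by field_simp; ring,
        div_le_div_iff₀ (by positivity) n0]
      nlinarith
    have h5 : (n/(n+1))^s ≤ 1 := Real.rpow_le_one (by positivity) (by rw [div_le_one (by linarith)]; linarith) (by linarith)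
    rw [h1]
    calc _ ≤ (1/n) * (2/n) := by
          apply mul_le_mul h3 (by linarith) (by linarith) (by positivity)
      _ = _ := by field_simp
  have a1 : ∀ w, n ≤ w → 1 / w ^ s ≤ 1 / n ^ s := fun w hw =>
    one_div_le_one_div_of_le (Real.rpow_pos_of_pos n0 s) (Real.rpow_le_rpow n0.le hw (by linarith))
  have a2 : ∀ w, n ≤ w → w ≤ n+1 → 1 / (n+1) ^ s ≤ 1 / w ^ s := fun w hw hw' =>
    one_div_le_one_div_of_le (Real.rpow_pos_of_pos (by linarith) s) (Real.rpow_le_rpow (by linarith) hw' (by linarith))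
  rw [abs_le]
  have := a1 u hu; have := a1 v hv; have := a2 u hu hu'; have := a2 v hv hv'
  constructor <;> linarith

lemma term_real (a : ℝ) (ha : a ∈ Set.Ioo (0:ℝ) 1) (s : ℝ) (n : ℕ) :
    (1 / (n + a : ℂ) ^ (s:ℂ) - 1 / (n + 1 - a : ℂ) ^ (s:ℂ)) / 2 =
      (((1 / (n + a) ^ s - 1 / (n + 1 - a) ^ s) / 2 : ℝ) : ℂ) := by
  have h1 : (0:ℝ) ≤ n + a := add_nonneg n.cast_nonneg ha.1.le
  have h2 : (0:ℝ) ≤ n + 1 - a := by have := ha.2; have : (0:ℝ) ≤ n := n.cast_nonneg; linarith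
  push_cast
  rw [Complex.ofReal_cpow h1, Complex.ofReal_cpow h2]
  push_cast
  rfl

lemma term_bound (a : ℝ) (ha : a ∈ Set.Ioo (0:ℝ) 1) (s : ℝ) (hs : 1 ≤ s) (hs2 : s ≤ 2) (n : ℕ) :
    |(1 / (n + a) ^ s - 1 / (n + 1 - a) ^ s) / 2| ≤
      2 / (n:ℝ) ^ 2 + (if n = 0 then 1 / a ^ 2 + 1 / (1-a)^2 else 0) := by
  obtain ⟨h0, h1⟩ := ha
  rcases Nat.eq_zero_or_pos n with rfl | hn
  · have aux : ∀ b : ℝ, 0 < b → b < 1 → 0 ≤ 1 / b ^ s ∧ 1 / b ^ s ≤ 1 / b ^ 2 := by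
      intro b hb hb1
      refine ⟨by positivity, one_div_le_one_div_of_le (by positivity) ?_⟩
      rw [← Real.rpow_two]
      exact Real.rpow_le_rpow_of_exponent_ge hb hb1.le hs2
    have A := aux a h0 h1
    have B := aux (1-a) (by linarith) (by linarith)
    simp only [Nat.cast_zero, zero_add, if_true]
    norm_num only
    rw [abs_le]
    constructor <;> linarith [A.1, A.2, B.1, B.2]
  · have hn1 : (1:ℝ) ≤ n := by exact_mod_cast hn
    have := four_bound (u := n + a) (v := n + 1 - a) (s := s) hn1 (by linarith) (by linarith) (by linarith) (by linarith) hs hs2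
    rw [if_neg hn.ne', add_zero, abs_div, abs_two]
    have := abs_nonneg (1 / ((n:ℝ) + a) ^ s - 1 / (n + 1 - a) ^ s)
    linarith

lemma bound_summable (K : ℝ) :
    Summable (fun n : ℕ => 2 / (n:ℝ) ^ 2 + (if n = 0 then K else 0)) := by
  apply Summable.add
  · have := (Real.summable_one_div_nat_pow (p := 2)).2 (by norm_num)
    simpa [div_eq_mul_inv] using this.mul_left 2
  · exact (hasSum_ite_eq 0 K).summable

open Filter Topology HurwitzZeta in
lemma hurwitzOdd_one (a : ℝ) (ha : a ∈ Set.Ioo (0:ℝ) 1) :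
    hurwitzZetaOdd a 1 = Real.pi / 2 * Complex.cot (Real.pi * a) := by
  set f : ℝ → ℕ → ℂ := fun s n => (1 / (n + a : ℂ) ^ (s:ℂ) - 1 / (n + 1 - a : ℂ) ^ (s:ℂ)) / 2 with hf
  have hbd : ∀ s : ℝ, 1 ≤ s → s ≤ 2 → ∀ n, ‖f s n‖ ≤ 2 / (n:ℝ) ^ 2 + (if n = 0 then 1 / a ^ 2 + 1 / (1-a)^2 else 0) := by
    intro s hs hs2 n
    simp only [hf]
    rw [term_real a ha, Complex.norm_real, Real.norm_eq_abs]
    exact term_bound a ha s hs hs2 n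
  have hev : ∀ᶠ s : ℝ in 𝓝[>] 1, 1 < s ∧ s ≤ 2 := by
    filter_upwards [Ioc_mem_nhdsGT (show (1:ℝ) < 2 by norm_num)] with s hs using hs
  have hlim : Tendsto (fun s : ℝ => ∑' n, f s n) (𝓝[>] 1) (𝓝 (∑' n, f 1 n)) := by
    apply tendsto_tsum_of_dominated_convergence (bound_summable _)
    · intro n
      have h1 : (n + a : ℂ) ≠ 0 := by
        have : (0:ℝ) < n + a := by have := ha.1; positivity
        exact_mod_cast this.ne'
      have h2 : (n + 1 - a : ℂ) ≠ 0 := by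
        have : (0:ℝ) < n + 1 - a := by have := ha.2; have : (0:ℝ) ≤ n := n.cast_nonneg; linarith
        exact_mod_cast this.ne'
      have : ContinuousAt (fun s : ℝ => f s n) 1 := by
        simp only [hf]
        have hc : ∀ z : ℂ, z ≠ 0 → ContinuousAt (fun s : ℝ => 1 / z ^ (s:ℂ)) 1 := by
          intro z hz
          apply ContinuousAt.div continuousAt_const
          · exact ContinuousAt.const_cpow Complex.continuous_ofReal.continuousAt (Or.inl hz)
          · simp [hz]
        exact ((hc _ h1).sub (hc _ h2)).div_const 2
      exact this.tendsto.mono_left nhdsWithin_le_nhds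
    · filter_upwards [hev] with s hs using hbd s hs.1.le hs.2
  have hlim2 : Tendsto (fun s : ℝ => ∑' n, f s n) (𝓝[>] 1) (𝓝 (hurwitzZetaOdd a 1)) := by
    have : ContinuousAt (fun s : ℝ => hurwitzZetaOdd a (s:ℂ)) 1 :=
      ((differentiable_hurwitzZetaOdd (a : UnitAddCircle)).continuous.comp Complex.continuous_ofReal).continuousAt
    have h := this.tendsto.mono_left (nhdsWithin_le_nhds (s := Set.Ioi 1))
    rw [Complex.ofReal_one] at h
    refine h.congr' ?_
    filter_upwards [hev] with s hs
    exact (hasSum_nat_hurwitzZetaOdd_of_mem_Icc ⟨ha.1.le, ha.2.le⟩ (s := (s:ℂ)) (by simpa using hs.1)).tsum_eq.symm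
  rw [tendsto_nhds_unique hlim2 hlim]
  have hsum : Summable (f 1) := Summable.of_norm_bounded (bound_summable _) (hbd 1 le_rfl (by norm_num))
  have hZ : (a:ℂ) ∈ Complex.integerComplement := by
    rw [Complex.mem_integerComplement_iff]
    rintro ⟨n, hn⟩
    have hn' : (n:ℝ) = a := by exact_mod_cast hn
    have h1 : (0:ℝ) < n := hn' ▸ ha.1
    have h2 : (n:ℝ) < 1 := hn' ▸ ha.2
    have h1' : 0 < n := by exact_mod_cast h1
    have h2' : n < 1 := by exact_mod_cast h2
    omega
  have hc := (summable_cotTerm hZ).hasSum.tendsto_sum_nat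
  have hrep := cot_series_rep' hZ
  have hcot : (∑' n, cotTerm (a:ℂ) n) = Real.pi * Complex.cot (Real.pi * a) - 1 / a := hrep.symm
  rw [hcot] at hc
  have key : ∀ N : ℕ, ∑ n ∈ Finset.range N, f 1 n =
      (1 / a + ∑ n ∈ Finset.range N, cotTerm (a:ℂ) n - 1 / ((N:ℂ) + a)) / 2 := by
    intro N
    induction N with
    | zero => simp
    | succ N ih =>
      rw [Finset.sum_range_succ, ih, Finset.sum_range_succ]
      simp only [hf, cotTerm, Complex.ofReal_one, Complex.cpow_one]
      have e1 : (1:ℂ) / (N + 1 - a) = - (1 / (a - (N+1))) := by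
        rw [← neg_sub, one_div, one_div, inv_neg]
      have e2 : (a:ℂ) + (N + 1) = (N + 1 : ℕ) + a := by push_cast; ring
      rw [e1, e2]
      ring
  have hN : Tendsto (fun N : ℕ => 1 / ((N:ℂ) + a)) atTop (𝓝 0) := by
    have : Tendsto (fun N : ℕ => 1 / ((N:ℝ) + a)) atTop (𝓝 0) := by
      simp only [one_div]
      exact (tendsto_natCast_atTop_atTop.atTop_add tendsto_const_nhds).inv_tendsto_atTop
    have := (Complex.continuous_ofReal.tendsto 0).comp this
    simpa [Function.comp_def] using this
  have hfin := ((hc.const_add (1 / (a:ℂ))).sub hN).div_const 2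
  have := tendsto_nhds_unique hsum.hasSum.tendsto_sum_nat (hfin.congr fun N => (key N).symm)
  rw [this]
  ring

/-- The sawtooth function on `ℤ/pℤ`. -/
noncomputable def saw (p : ℕ) (x : ZMod p) : ℂ := if x = 0 then 0 else (x.val : ℂ) / p - 1 / 2

lemma saw_dft (p : ℕ) [Fact p.Prime] (k : ZMod p) (hk : k ≠ 0) :
    ∑ j : ZMod p, saw p j * ZMod.stdAddChar (j * k) =
      -(Complex.I / 2) * Complex.cot (Real.pi * ((k.val / p : ℝ) : ℂ)) := by
  have hp : p.Prime := Fact.out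
  have hp0 : (p:ℂ) ≠ 0 := by exact_mod_cast hp.ne_zero
  set ω : ℂ := ZMod.stdAddChar k with hω
  have hω1 : ω ≠ 1 := by
    intro h
    apply hk
    apply ZMod.injective_stdAddChar
    rw [← hω, h, AddChar.map_zero_eq_one]
  have hprim : (ZMod.stdAddChar (N := p)).IsPrimitive := ZMod.isPrimitive_stdAddChar p
  have hsum0 : ∑ j : ZMod p, ZMod.stdAddChar (j * k) = (0:ℂ) := by
    have := AddChar.sum_mulShift k hprim
    simpa [hk] using this
  set D : ℂ := ∑ j : ZMod p, (j.val : ℂ) * ZMod.stdAddChar (j * k) with hD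
  have hshift : ω * D = ∑ j : ZMod p, ((j - 1).val : ℂ) * ZMod.stdAddChar (j * k) := by
    rw [hD, Finset.mul_sum]
    refine Fintype.sum_equiv (Equiv.addRight 1) _ _ fun j => ?_
    simp only [Equiv.coe_addRight, add_sub_cancel_right, add_mul, one_mul, AddChar.map_add_eq_mul]
    ring
  have hdiff : D - ω * D = -p := by
    rw [hshift, hD, ← Finset.sum_sub_distrib]
    have : ∀ j : ZMod p, (j.val : ℂ) * ZMod.stdAddChar (j * k) - ((j - 1).val : ℂ) * ZMod.stdAddChar (j * k)
        = ZMod.stdAddChar (j * k) - (if j = 0 then (p:ℂ) else 0) := by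
      intro j
      have v1 : (1 : ZMod p).val = 1 := ZMod.val_one p
      split_ifs with h
      · subst h
        rw [zero_sub, ZMod.neg_val, if_neg one_ne_zero, v1, Nat.cast_sub hp.one_le]
        simp
      · have : 1 ≤ j.val := Nat.one_le_iff_ne_zero.2 (by simpa using h)
        rw [ZMod.val_sub (by rw [v1]; exact this), v1, Nat.cast_sub this]
        push_cast; ring
    rw [Finset.sum_congr rfl fun j _ => this j, Finset.sum_sub_distrib, hsum0]
    simp
  have hsaw : ∑ j : ZMod p, saw p j * ZMod.stdAddChar (j * k) = D / p + 1 / 2 := by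
    have : ∀ j : ZMod p, saw p j * ZMod.stdAddChar (j * k) =
        (j.val : ℂ) * ZMod.stdAddChar (j * k) / p - 1 / 2 * ZMod.stdAddChar (j * k) + (if j = 0 then 1/2 else 0) := by
      intro j
      unfold saw
      split_ifs with h
      · subst h; simp
      · ring
    rw [Finset.sum_congr rfl fun j _ => this j, Finset.sum_add_distrib, Finset.sum_sub_distrib,
      ← Finset.mul_sum, hsum0, ← Finset.sum_div]
    simp [hD]
  have hωe : Complex.exp (2 * Real.pi * Complex.I * ((k.val / p : ℝ) : ℂ)) = ω := by
    rw [hω, ZMod.stdAddChar_apply, ZMod.toCircle_apply]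
    congr 1; push_cast; ring
  rw [hsaw, Complex.cot_pi_eq_exp_ratio, hωe]
  have h1 : 1 - ω ≠ 0 := sub_ne_zero.2 (Ne.symm hω1)
  have hDv : D = -p / (1 - ω) := by
    rw [eq_div_iff h1]; linear_combination hdiff
  rw [hDv]
  have hI := Complex.I_ne_zero
  field_simp
  ring

lemma T_ne_zero (p : ℕ) [Fact p.Prime] (χ : DirichletCharacter ℂ p) (hχ : χ.Odd) :
    ∑ k : ZMod p, χ k * ∑ j : ZMod p, saw p j * ZMod.stdAddChar (j * k) ≠ 0 := by
  have hp : p.Prime := Fact.out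
  have hp0 : (p:ℂ) ≠ 0 := by exact_mod_cast hp.ne_zero
  have hne : χ ≠ 1 := by
    rintro rfl
    have h : (1 : DirichletCharacter ℂ p) (-1) = -1 := hχ
    rw [MulChar.one_apply (isUnit_one.neg)] at h
    norm_num at h
  have hL := DirichletCharacter.LFunction_apply_one_ne_zero hne
  have hodd : Function.Odd (χ : ZMod p → ℂ) := hχ.to_fun
  rw [DirichletCharacter.LFunction, ZMod.LFunction_def_odd hodd] at hL
  intro h0
  apply hL
  have : ∀ k : ZMod p, χ k * HurwitzZeta.hurwitzZetaOdd (ZMod.toAddCircle k) 1 =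
      (Real.pi * Complex.I) * (χ k * ∑ j : ZMod p, saw p j * ZMod.stdAddChar (j * k)) := by
    intro k
    by_cases hk : k = 0
    · subst hk; simp [hodd.map_zero]
    · have hpp : (0:ℝ) < p := by exact_mod_cast hp.pos
      have hv : (0:ℝ) < k.val := by
        have : 0 < k.val := Nat.pos_of_ne_zero (by simpa using hk)
        exact_mod_cast this
      have hv2 : (k.val:ℝ) < p := by exact_mod_cast k.val_lt
      rw [saw_dft p k hk, ZMod.toAddCircle_apply, hurwitzOdd_one _ ⟨by positivity, (div_lt_one hpp).2 hv2⟩]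
      linear_combination (χ k * (Real.pi/2) * Complex.cot (Real.pi * ((k.val / p : ℝ) : ℂ))) * Complex.I_mul_I
  rw [Finset.sum_congr rfl fun k _ => this k, ← Finset.mul_sum, h0]
  simp

lemma T_scale (p : ℕ) [Fact p.Prime] (χ : DirichletCharacter ℂ p) (a : ZMod p) (ha : a ≠ 0) :
    ∑ k : ZMod p, χ k * ∑ j : ZMod p, saw p (j * a) * ZMod.stdAddChar (j * k) =
    χ a * ∑ k : ZMod p, χ k * ∑ j : ZMod p, saw p j * ZMod.stdAddChar (j * k) := by
  rw [Finset.mul_sum]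
  symm
  refine Fintype.sum_equiv (Equiv.mulRight₀ a ha) _ _ fun k => ?_
  rw [← mul_assoc]
  simp only [Equiv.mulRight₀_apply, map_mul]
  rw [mul_comm (χ a)]
  congr 1
  symm
  refine Fintype.sum_equiv (Equiv.mulRight₀ a ha) _ _ fun j => ?_
  simp only [Equiv.mulRight₀_apply]
  congr 2
  ring

lemma chars_zero (p : ℕ) [Fact p.Prime] (χ : DirichletCharacter ℂ p) (hχ : χ.Odd) (a b c d : ZMod p)
    (ha : a ≠ 0) (hb : b ≠ 0) (hc : c ≠ 0) (hd : d ≠ 0)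
    (h : ∀ m : ZMod p, saw p (m * a) + saw p (m * b) + saw p (m * c) + saw p (m * d) = 0) :
    χ a + χ b + χ c + χ d = 0 := by
  have hT := T_ne_zero p χ hχ
  refine (mul_eq_zero.1 ?_).resolve_right hT
  rw [add_mul, add_mul, add_mul, ← T_scale p χ a ha, ← T_scale p χ b hb, ← T_scale p χ c hc,
    ← T_scale p χ d hd, ← Finset.sum_add_distrib, ← Finset.sum_add_distrib, ← Finset.sum_add_distrib]
  refine Finset.sum_eq_zero fun k _ => ?_
  rw [← mul_add, ← mul_add, ← mul_add, ← Finset.sum_add_distrib, ← Finset.sum_add_distrib,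
    ← Finset.sum_add_distrib]
  rw [Finset.sum_eq_zero, mul_zero]
  intro j _
  rw [← add_mul, ← add_mul, ← add_mul, h, zero_mul]

lemma neg_mem (p : ℕ) [Fact p.Prime] (a b c d : ZMod p)
    (ha : a ≠ 0) (hb : b ≠ 0) (hc : c ≠ 0) (hd : d ≠ 0) (h2 : a ≠ -a)
    (h : ∀ m : ZMod p, saw p (m * a) + saw p (m * b) + saw p (m * c) + saw p (m * d) = 0) :
    a = -b ∨ a = -c ∨ a = -d := by
  by_contra hcon
  push Not at hcon
  obtain ⟨h3, h4, h5⟩ := hcon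
  have hp : p.Prime := Fact.out
  have hall : ∀ χ : DirichletCharacter ℂ p,
      χ a⁻¹ * χ a + χ a⁻¹ * χ b + χ a⁻¹ * χ c + χ a⁻¹ * χ d
       = χ a⁻¹ * χ (-a) + χ a⁻¹ * χ (-b) + χ a⁻¹ * χ (-c) + χ a⁻¹ * χ (-d) := by
    intro χ
    rcases χ.even_or_odd with he | ho
    · simp only [he.eval_neg]
    · simp only [ho.eval_neg]
      linear_combination (2 * χ a⁻¹) * chars_zero p χ ho a b c d ha hb hc hd h
  have hs := Finset.sum_congr (rfl : (Finset.univ : Finset (DirichletCharacter ℂ p)) = _) fun χ _ => hall χ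
  simp only [Finset.sum_add_distrib, DirichletCharacter.sum_char_inv_mul_char_eq ℂ (isUnit_iff_ne_zero.2 ha)] at hs
  rw [if_pos trivial, if_neg h2, if_neg h3, if_neg h4, if_neg h5] at hs
  have ht : 0 < p.totient := Nat.totient_pos.2 hp.pos
  have hs' : (p.totient + (if a = b then p.totient else 0) + (if a = c then p.totient else 0)
    + (if a = d then p.totient else 0) : ℕ) = 0 := by
    have : ((p.totient + (if a = b then p.totient else 0) + (if a = c then p.totient else 0)
    + (if a = d then p.totient else 0) : ℕ) : ℂ) = 0 := by
      push_cast
      simpa using hs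
    exact_mod_cast this
  omega

lemma nval_neg (p : ℕ) [Fact p.Prime] (x : ZMod p) (hx : x ≠ 0) : (-x).val + x.val = p := by
  rw [ZMod.neg_val, if_neg hx]
  have := x.val_lt
  omega

lemma zmod_two_key : ∀ x y : ZMod 2, x ≠ 0 → y ≠ 0 → x + y = 0 := by decide

theorem stmt_3 (p : ℕ) (hp : p.Prime) (S : Multiset (ZMod p))
    (hcard : Multiset.card S = 4)
    (hsum : S.sum = 0)
    (hmin : ∀ T ≤ S, T ≠ 0 → T ≠ S → T.sum ≠ 0) :
    ∃ m : ℤ, IsCoprime m (p : ℤ) ∧ sigmaM p m S = p := by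
  have : Fact p.Prime := ⟨hp⟩
  obtain ⟨a, b, c, d, rfl⟩ : ∃ a b c d : ZMod p, S = {a, b, c, d} := by
    induction S using Quotient.inductionOn with
    | h l =>
      match l, hcard with
      | [a, b, c, d], _ => exact ⟨a, b, c, d, rfl⟩
  have single : ∀ x : ZMod p, x ∈ ({a, b, c, d} : Multiset (ZMod p)) → x ≠ 0 := by
    intro x hx h0
    refine hmin {x} (Multiset.singleton_le.2 hx) (by simp) ?_ (by simpa using h0)
    intro h
    have := congrArg Multiset.card h
    simp at this
  have pair : ∀ x y : ZMod p, ({x, y} : Multiset (ZMod p)) ≤ {a, b, c, d} → x + y ≠ 0 := by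
    intro x y hx h0
    refine hmin {x, y} hx (by simp) ?_ (by simpa using h0)
    intro h
    have := congrArg Multiset.card h
    simp at this
  have ha := single a (by simp)
  have hb := single b (by simp)
  have hc := single c (by simp)
  have hd := single d (by simp)
  have hab : a + b ≠ 0 := pair a b (Multiset.cons_le_cons _ (Multiset.cons_le_cons _ (Multiset.zero_le _)))
  have hac : a + c ≠ 0 := pair a c (Multiset.cons_le_cons _ ((Multiset.cons_le_cons _ (Multiset.zero_le _)).trans (Multiset.le_cons_self _ _)))
  have had : a + d ≠ 0 := pair a d (Multiset.cons_le_cons _ (Multiset.singleton_le.2 (by simp)))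
  have hs0 : a + b + c + d = 0 := by
    simp at hsum; linear_combination hsum
  by_contra hcon
  push Not at hcon
  have hne : ∀ m : ZMod p, m ≠ 0 → (m * a).val + (m * b).val + (m * c).val + (m * d).val ≠ p := by
    intro m hm
    have hcop : IsCoprime (m.val : ℤ) (p : ℤ) := by
      rw [Nat.isCoprime_iff_coprime, Nat.coprime_comm, hp.coprime_iff_not_dvd]
      intro h
      have h1 := Nat.eq_zero_of_dvd_of_lt h m.val_lt
      exact hm (by simpa using h1)
    have := hcon m.val hcop
    have hz : ∀ x : ZMod p, x ≠ 0 → nval p ((m.val : ℤ) • x) = (m * x).val := by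
      intro x hx
      have : ((m.val : ℤ) • x) = m * x := by
        rw [zsmul_eq_mul]; simp
      rw [this, nval, if_neg (mul_ne_zero hm hx)]
    intro h
    apply this
    simp only [sigmaM, Multiset.insert_eq_cons, Multiset.map_cons, Multiset.map_singleton,
      Multiset.sum_cons, Multiset.sum_singleton]
    rw [hz a ha, hz b hb, hz c hc, hz d hd]
    omega
  have h2p : ∀ m : ZMod p, m ≠ 0 → (m * a).val + (m * b).val + (m * c).val + (m * d).val = 2 * p := by
    intro m hm
    have h1 := hne m hm
    have h3 := hne (-m) (neg_ne_zero.2 hm)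
    simp only [neg_mul] at h3
    have na := nval_neg p (m * a) (mul_ne_zero hm ha)
    have nb := nval_neg p (m * b) (mul_ne_zero hm hb)
    have nc := nval_neg p (m * c) (mul_ne_zero hm hc)
    have nd := nval_neg p (m * d) (mul_ne_zero hm hd)
    have pa : 0 < (m * a).val := Nat.pos_of_ne_zero (by simp [hm, ha])
    have la := (m * a).val_lt
    have lb := (m * b).val_lt
    have lc := (m * c).val_lt
    have ld := (m * d).val_lt
    have hdvd : p ∣ (m * a).val + (m * b).val + (m * c).val + (m * d).val := by
      rw [← ZMod.natCast_eq_zero_iff]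
      push_cast
      simp only [ZMod.natCast_zmod_val]
      linear_combination m * hs0
    obtain ⟨q, hq⟩ := hdvd
    have q4 : q < 4 := by
      by_contra h
      have : p * 4 ≤ p * q := Nat.mul_le_mul_left p (by omega)
      omega
    interval_cases q <;> omega
  have hsaw : ∀ m : ZMod p, saw p (m * a) + saw p (m * b) + saw p (m * c) + saw p (m * d) = 0 := by
    intro m
    by_cases hm : m = 0
    · simp [hm, saw]
    · have h := h2p m hm
      have h' : (((m * a).val : ℂ) + (m * b).val + (m * c).val + (m * d).val) = 2 * p := by
        exact_mod_cast h
      have hp0 : (p:ℂ) ≠ 0 := by exact_mod_cast hp.ne_zero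
      simp only [saw, mul_eq_zero, hm, ha, hb, hc, hd, or_self, if_false]
      field_simp
      linear_combination 2 * h'
  by_cases h2 : a = -a
  · have hp2 : p = 2 := by
      have h : (2 : ZMod p) * a = 0 := by linear_combination h2
      have h' : ((2 : ℕ) : ZMod p) = 0 := by
        simpa [ha] using h
      rw [ZMod.natCast_eq_zero_iff] at h'
      exact (Nat.prime_dvd_prime_iff_eq hp Nat.prime_two).1 h'
    subst hp2
    exact hab (zmod_two_key a b ha hb)
  · rcases neg_mem p a b c d ha hb hc hd h2 hsaw with h | h | h
    · exact hab (by rw [h]; ring)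
    · exact hac (by rw [h]; ring)
    · exact had (by rw [h]; ring)
end

section
/- Let n be a positive integer and let S be a minimal zero-sum sequence of elements of ℤ/nℤ with |S| ∈ {1,2,3}. Then Index(S) = n; that is, there exists an integer m coprime to n with σ(|mS|_n) = n. -/
theorem nval_neg_add (n : ℕ) [NeZero n] (a : ZMod n) (ha : a ≠ 0) :
    nval n (-a) + a.val = n := by
  have h := ZMod.neg_val a
  rw [if_neg ha] at h
  have := ZMod.val_lt a
  rw [nval, if_neg (neg_ne_zero.mpr ha), h]
  omega

/-- Lemma 3.2: if `S` is a minimal zero-sum sequence over `ℤ/nℤ` with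
`|S| ∈ {1,2,3}`, then `Index(S) = n`; that is, some `m` coprime to `n`
satisfies `σ(|mS|ₙ) = n`. -/
theorem stmt_5 (n : ℕ) (hn : 0 < n) (S : Multiset (ZMod n))
    (hcard : Multiset.card S = 1 ∨ Multiset.card S = 2 ∨ Multiset.card S = 3)
    (hsum : S.sum = 0)
    (hmin : ∀ T ≤ S, T ≠ 0 → T ≠ S → T.sum ≠ 0) :
    ∃ m : ℤ, IsCoprime m (n : ℤ) ∧ sigmaM n m S = n := by
  haveI : NeZero n := ⟨hn.ne'⟩
  rcases hcard with h | h | h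
  · obtain ⟨a, rfl⟩ := Multiset.card_eq_one.mp h
    simp only [Multiset.sum_singleton] at hsum
    subst hsum
    exact ⟨1, isCoprime_one_left, by simp [sigmaM, nval]⟩
  · obtain ⟨a, b, rfl⟩ := Multiset.card_eq_two.mp h
    have ha : a ≠ 0 := by
      have := hmin {a} (by simp) (by simp) (fun e => by simpa using congrArg Multiset.card e)
      simpa using this
    have hb : b = -a := by
      simp at hsum
      exact (neg_eq_of_add_eq_zero_right hsum).symm
    subst hb
    refine ⟨1, isCoprime_one_left, ?_⟩
    have h1 := nval_neg_add n a ha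
    have h2 : nval n a = a.val := by rw [nval, if_neg ha]
    simp [sigmaM]
    omega
  · obtain ⟨a, b, c, rfl⟩ := Multiset.card_eq_three.mp h
    have key : ∀ x ∈ ({a, b, c} : Multiset (ZMod n)), x ≠ 0 := by
      intro x hx
      have := hmin {x} (Multiset.singleton_le.mpr hx) (by simp)
        (fun e => by simpa using congrArg Multiset.card e)
      simpa using this
    have ha := key a (by simp)
    have hb := key b (by simp)
    have hc := key c (by simp)
    have hs : a + b + c = 0 := by simpa [add_assoc] using hsum
    have hd : n ∣ a.val + b.val + c.val := by
      rw [← ZMod.natCast_eq_zero_iff]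
      simpa using hs
    obtain ⟨k, hk⟩ := hd
    have la := ZMod.val_lt a
    have lb := ZMod.val_lt b
    have lc := ZMod.val_lt c
    have pa : 0 < a.val := ZMod.val_pos.mpr ha
    have k3 : k < 3 := by
      by_contra hh
      have : n * 3 ≤ n * k := Nat.mul_le_mul_left n (by omega)
      omega
    have n1 := nval_neg_add n a ha
    have n2 := nval_neg_add n b hb
    have n3 := nval_neg_add n c hc
    interval_cases k
    · omega
    · refine ⟨1, isCoprime_one_left, ?_⟩
      simp [sigmaM, nval, ha, hb, hc]
      omega
    · refine ⟨-1, isCoprime_one_left.neg_left, ?_⟩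
      simp [sigmaM]
      omega
end

section
/- Let n be a positive integer and h an integer with n/2 ≤ h ≤ n. Let S be the sequence over ℤ/nℤ consisting of the element 1 repeated h times together with elements b_1, …, b_{n−h} of ℤ/nℤ (so |S| = n). Suppose S contains no nonempty subsequence T with |T| ≤ h and with index n (i.e., no nonempty T | S with |T| ≤ h admits m coprime to n with σ(|mT|_n) = n). Then for every t ∈ [1, n−h] and every t-element subset {i_1, …, i_t} of [1, n−h], one has |b_{i_1}|_n + ⋯ + |b_{i_t}|_n ≤ n − h + t − 1. -/
theorem nval_one (n : ℕ) (hn : 0 < n) : nval n (1 : ZMod n) = 1 := by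
  unfold nval
  rcases Nat.lt_or_ge 1 n with h | h
  · have : Fact (1 < n) := ⟨h⟩
    rw [if_neg one_ne_zero, ZMod.val_one]
  · obtain rfl : n = 1 := by omega
    rw [if_pos (Subsingleton.elim _ _)]

theorem nval_le (n : ℕ) (hn : 0 < n) (x : ZMod n) : nval n x ≤ n := by
  unfold nval
  have : NeZero n := ⟨hn.ne'⟩
  split_ifs
  · exact le_rfl
  · exact (ZMod.val_lt x).le

/-- Inequality (3.1) in the proof of Theorem 1.4: if `S = 1^h b₁ ⋯ b_{n-h}` is a
sequence of `n` elements of `ℤ/nℤ` with `n/2 ≤ h ≤ n` containing no nonempty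
subsequence of length at most `h` and of index `n`, then for every nonempty
subset `{i₁, …, i_t}` of `[1, n-h]` one has
`|b_{i₁}|ₙ + ⋯ + |b_{i_t}|ₙ ≤ n - h + t - 1`. -/
theorem stmt_6 (n h : ℕ) (hn : 0 < n) (hh1 : n ≤ 2 * h) (hh2 : h ≤ n)
    (b : Fin (n - h) → ZMod n)
    (S : Multiset (ZMod n))
    (hS : S = Multiset.replicate h (1 : ZMod n) + Finset.univ.val.map b)
    (hno : ¬ ∃ T ≤ S, T ≠ 0 ∧ Multiset.card T ≤ h ∧
        ∃ m : ℤ, IsCoprime m (n : ℤ) ∧ sigmaM n m T = n) :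
    ∀ I : Finset (Fin (n - h)), I.Nonempty →
      ∑ i ∈ I, nval n (b i) ≤ n - h + I.card - 1 := by
  intro I
  induction I using Finset.strongInduction with
  | H I ih =>
  intro hI
  by_contra hcon
  push Not at hcon
  have hk : 0 < I.card := hI.card_pos
  have hkle : I.card ≤ n - h := by
    simpa using Finset.card_le_univ I
  rcases Nat.lt_or_ge n (∑ i ∈ I, nval n (b i)) with hlt | hle
  · obtain ⟨j, hj⟩ := hI
    have key : ∀ i ∈ I, 2 ≤ I.card → (h : ℤ) - I.card + 3 ≤ nval n (b i) := by
      intro i hi h2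
      have hc := Finset.card_erase_of_mem hi
      have h3 := ih (I.erase i) (Finset.erase_ssubset hi)
        (Finset.card_pos.mp (by omega))
      have h4 := Finset.add_sum_erase I (fun i => nval n (b i)) hi
      omega
    have h4 := Finset.add_sum_erase I (fun i => nval n (b i)) hj
    have hc := Finset.card_erase_of_mem hj
    rcases Nat.lt_or_ge I.card 2 with h1 | h2
    · have h5 : I.erase j = ∅ := Finset.card_eq_zero.mp (by omega)
      rw [h5, Finset.sum_empty] at h4
      have := nval_le n hn (b j)
      omega
    · have h3 := ih (I.erase j) (Finset.erase_ssubset hj)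
        (Finset.card_pos.mp (by omega))
      have h6 : ((I.erase j).card : ℤ) * ((h : ℤ) - I.card + 3)
          ≤ ((∑ i ∈ I.erase j, nval n (b i) : ℕ) : ℤ) := by
        push_cast
        rw [← nsmul_eq_mul]
        exact Finset.card_nsmul_le_sum _ _ _
          (fun i hi => key i (Finset.mem_of_mem_erase hi) h2)
      obtain ⟨t, ht⟩ : ∃ t : ℕ, I.card = t + 1 := ⟨I.card - 1, by omega⟩
      have ht' : (I.erase j).card = t := by omega
      rw [ht', ht] at h6
      rw [ht'] at h3
      have h7 : ((∑ i ∈ I.erase j, nval n (b i) : ℕ) : ℤ) ≤ h + t - 1 := by omega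
      have h8 : (1 : ℤ) ≤ t := by omega
      have h9 : (t : ℤ) + 1 ≤ h := by omega
      push_cast at h6 h7
      nlinarith [mul_nonneg (sub_nonneg.mpr h8) (show (0 : ℤ) ≤ h - t by omega)]
  · apply hno
    refine ⟨Multiset.replicate (n - ∑ i ∈ I, nval n (b i)) 1 + I.val.map b, ?_, ?_, ?_,
      1, isCoprime_one_left, ?_⟩
    · rw [hS]
      apply add_le_add
      · exact (Multiset.replicate_le_replicate _).mpr (by omega)
      · exact Multiset.map_le_map (Finset.val_le_iff.mpr (Finset.subset_univ I))
    · intro h0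
      have := congrArg Multiset.card h0
      simp at this
      have h2 := this.2
      simp [h2] at hk
    · simp
      omega
    · have hsum : (Multiset.map (fun i => nval n (b i)) I.val).sum
          = ∑ i ∈ I, nval n (b i) := rfl
      simp [sigmaM, nval_one n hn, hsum, Function.comp_def]
      omega
end
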